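/- arXiv:1705.02418 — 4 statements merged into one kernel-verified Lean document; each statement's English description precedes it below -/
import Mathlib

section
/- Let G be a simple graph on [0,n]. Let P^c be the capacitated flow polytope of the augmented graph G^aug with netflow b_G^∅ = (indeg_G(1), ..., indeg_G(n), −#E(G)), i.e., the set of flows f on G^aug with this netflow satisfying 0 ≤ f(y_{(j,i)}) ≤ 1 for every y-edge, and let φ send such a flow f to (f(a_1),...,f(a_n)) ∈ ℝ^n. For each F ⊆ E(G\0), let S_F = { ψ(g) : g an integral flow on H_G with netflow b_G^F }. Then φ(P^c) equals the convex hull of the union ∪_{F ⊆ E(G\0)} S_F, and every integer point of φ(P^c) lies in this union. (Equivalently, the left-degree polynomial L_G has polytopal support and φ(P^c) is its Newton polytope.) -/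
noncomputable section

open Finset

/-- The flow polytope of a directed graph with edge index set `ι`, edges `e` going from
`src e` to `tgt e`, and netflow vector `a`. -/
def flowPolytope {V ι : Type*} [Fintype ι] [DecidableEq V]
    (src tgt : ι → V) (a : V → ℝ) : Set (ι → ℝ) :=
  {f | (∀ e, 0 ≤ f e) ∧
    ∀ v, (∑ e, if src e = v then f e else 0) - (∑ e, if tgt e = v then f e else 0) = a v}

/-- `E(G\0)`: the edges of `G` not incident to the vertex `0`. -/
def EG0 (n : ℕ) (G : Finset (Fin (n + 1) × Fin (n + 1))) :
    Finset (Fin (n + 1) × Fin (n + 1)) :=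
  G.filter fun e => (e.1 : ℕ) ≠ 0

/-- Source map of the graph `H_G` on the vertex set `[n] ∪ {t}` (modeled as
`Option (Fin (n+1))` with `none = t`; the vertex `some 0` is unused): the edges are the
edges `(j,i)` of `G` with `1 ≤ j < i ≤ n` together with one edge `(j,t)` for each
`j ∈ [n]`. -/
def srcH (n : ℕ) (G : Finset (Fin (n + 1) × Fin (n + 1))) :
    (↥(EG0 n G) ⊕ Fin n) → Option (Fin (n + 1))
  | Sum.inl e => some e.1.1
  | Sum.inr i => some i.succ

/-- Target map of `H_G`. -/
def tgtH (n : ℕ) (G : Finset (Fin (n + 1) × Fin (n + 1))) :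
    (↥(EG0 n G) ⊕ Fin n) → Option (Fin (n + 1))
  | Sum.inl e => some e.1.2
  | Sum.inr _ => none

/-- `indeg_G(v)`: number of edges of `G` ending at `v`. -/
def indeg (n : ℕ) (G : Finset (Fin (n + 1) × Fin (n + 1))) (v : Fin (n + 1)) : ℕ :=
  (G.filter fun e => e.2 = v).card

/-- `outdeg_F(v)`: number of edges of `F` starting at `v`. -/
def outdeg (n : ℕ) (F : Finset (Fin (n + 1) × Fin (n + 1))) (v : Fin (n + 1)) : ℕ :=
  (F.filter fun e => e.1 = v).card

/-- The netflow vector `b_G^F = (indeg_G(1) − outdeg_F(1), …, indeg_G(n) − outdeg_F(n),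
−#E(G\F))` on the vertices of `H_G`. -/
def bGF (n : ℕ) (G F : Finset (Fin (n + 1) × Fin (n + 1))) : Option (Fin (n + 1)) → ℝ
  | none => -((G.card : ℝ) - (F.card : ℝ))
  | some v => if v = 0 then 0 else (indeg n G v : ℝ) - (outdeg n F v : ℝ)

/-- `z_I^F = min { ∑_{i∈I} f(i,t) : f a flow on H_G with netflow b_G^F }`. -/
def zI (n : ℕ) (G F : Finset (Fin (n + 1) × Fin (n + 1))) (I : Finset (Fin n)) : ℝ :=
  sInf ((fun f => ∑ i ∈ I, f (Sum.inr i)) ''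
    flowPolytope (srcH n G) (tgtH n G) (bGF n G F))


/-- `S_F = ψ(integral flows on H_G with netflow b_G^F) ⊆ ℝ^n`, where
`ψ(f) = (f(1,t),…,f(n,t))`. -/
def ldSet (n : ℕ) (G F : Finset (Fin (n + 1) × Fin (n + 1))) : Set (Fin n → ℝ) :=
  {x | ∃ f ∈ flowPolytope (srcH n G) (tgtH n G) (bGF n G F),
    (∀ e, ∃ z : ℤ, f e = (z : ℝ)) ∧ x = fun i => f (Sum.inr i)}

/-- Source map of the augmented graph `G^aug` on the vertex set `[n] ∪ {t}` (modeled as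
`Option (Fin (n+1))` with `none = t`; the vertex `some 0` is unused).  Its edges are: one
edge `a_j : j → t` for each `j ∈ [n]`, one edge `z_{(j,i)} : j → i` for each
`(j,i) ∈ E(G\0)`, and one edge `y_{(j,i)} : j → t` for each `(j,i) ∈ E(G\0)`. -/
def srcAug (n : ℕ) (G : Finset (Fin (n + 1) × Fin (n + 1))) :
    (Fin n ⊕ ↥(EG0 n G) ⊕ ↥(EG0 n G)) → Option (Fin (n + 1))
  | Sum.inl j => some j.succ
  | Sum.inr (Sum.inl e) => some e.1.1
  | Sum.inr (Sum.inr e) => some e.1.1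

/-- Target map of `G^aug`. -/
def tgtAug (n : ℕ) (G : Finset (Fin (n + 1) × Fin (n + 1))) :
    (Fin n ⊕ ↥(EG0 n G) ⊕ ↥(EG0 n G)) → Option (Fin (n + 1))
  | Sum.inl _ => none
  | Sum.inr (Sum.inl e) => some e.1.2
  | Sum.inr (Sum.inr _) => none

/-- The capacitated flow polytope `P^c` of `G^aug` with netflow
`b_G^∅ = (indeg_G(1), …, indeg_G(n), −#E(G))` and capacities `0 ≤ f ≤ 1` on the
`y`-edges. -/
def capAug (n : ℕ) (G : Finset (Fin (n + 1) × Fin (n + 1))) :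
    Set ((Fin n ⊕ ↥(EG0 n G) ⊕ ↥(EG0 n G)) → ℝ) :=
  {f | f ∈ flowPolytope (srcAug n G) (tgtAug n G) (bGF n G ∅) ∧
    ∀ e : ↥(EG0 n G), f (Sum.inr (Sum.inr e)) ≤ 1}

/-- The netflow (outflow minus inflow) of a function on the edges, as a linear map. -/
def netflow {V ι : Type*} [Fintype ι] [DecidableEq V] (src tgt : ι → V) :
    (ι → ℝ) →ₗ[ℝ] (V → ℝ) where
  toFun f v := (∑ e, if src e = v then f e else 0) - (∑ e, if tgt e = v then f e else 0)
  map_add' f g := by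
    ext v
    simp only [Pi.add_apply, ← Finset.sum_filter, Finset.sum_add_distrib]
    ring
  map_smul' r f := by
    ext v
    simp only [Pi.smul_apply, smul_eq_mul, ← Finset.sum_filter, ← Finset.mul_sum, RingHom.id_apply]
    ring

/-- The additive subgroup of integers in `ℝ`. -/
abbrev realInts : AddSubgroup ℝ := (Int.castAddHom ℝ).range

section Integrality

variable {V ι : Type*} [Fintype ι] [DecidableEq V] {src tgt : ι → V}

theorem mem_flowPolytope_iff {a : V → ℝ} {f : ι → ℝ} :
    f ∈ flowPolytope src tgt a ↔ (∀ e, 0 ≤ f e) ∧ netflow src tgt f = a := by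
  simp [flowPolytope, netflow, funext_iff]

theorem netflow_apply (f : ι → ℝ) (v : V) :
    netflow src tgt f v = (∑ e with src e = v, f e) - ∑ e with tgt e = v, f e := by
  simp [netflow, Finset.sum_filter]

theorem sum_netflow [Fintype V] (f : ι → ℝ) : ∑ v, netflow src tgt f v = 0 := by
  simp only [netflow_apply, Finset.sum_sub_distrib, Finset.sum_fiberwise, sub_self]

/-- A vertex with integral netflow meeting a non-integral edge meets at least two of them. -/
theorem two_le_degree_of_netflow_mem {f : ι → ℝ} {v : V} {S : Finset ι}
    (hS : ∀ e, e ∈ S ↔ f e ∉ realInts) (hv : netflow src tgt f v ∈ realInts)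
    (h : ∃ e ∈ S, src e = v ∨ tgt e = v) :
    2 ≤ #{e ∈ S | src e = v} + #{e ∈ S | tgt e = v} := by
  classical
  have key : ∀ p : ι → V, #{e ∈ S | p e = v} = 0 → ∑ e with p e = v, f e ∈ realInts := by
    intro p hp
    refine sum_mem fun e he => ?_
    by_contra hne
    rw [Finset.card_eq_zero] at hp
    refine Finset.notMem_empty e ?_
    rw [← hp, Finset.mem_filter, hS]
    exact ⟨hne, (Finset.mem_filter.mp he).2⟩
  have key' : ∀ p : ι → V, #{e ∈ S | p e = v} = 1 → ∑ e with p e = v, f e ∉ realInts := by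
    intro p hp hmem
    obtain ⟨e₀, he₀⟩ := Finset.card_eq_one.mp hp
    have h₀ : e₀ ∈ S ∧ p e₀ = v := by
      simpa using (he₀ ▸ Finset.mem_singleton_self e₀ : e₀ ∈ ({e ∈ S | p e = v} : Finset ι))
    have hmem₀ : e₀ ∈ ({e | p e = v} : Finset ι) := by simpa using h₀.2
    rw [← Finset.add_sum_erase _ _ hmem₀] at hmem
    refine (hS e₀).mp h₀.1 ((AddSubgroup.add_mem_cancel_right _ (sum_mem fun e he => ?_)).mp hmem)
    by_contra hne
    have : e ∈ ({e ∈ S | p e = v} : Finset ι) := by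
      simp only [Finset.mem_erase, Finset.mem_filter, Finset.mem_univ, true_and] at he
      simp [(hS e).mpr hne, he.2]
    rw [he₀, Finset.mem_singleton] at this
    exact (Finset.mem_erase.mp he).1 this
  rw [netflow_apply] at hv
  by_contra! hlt
  have hpos : 0 < #{e ∈ S | src e = v} + #{e ∈ S | tgt e = v} := by
    obtain ⟨e, he, h | h⟩ := h
    · exact Nat.add_pos_left (Finset.card_pos.mpr ⟨e, by simp [he, h]⟩) _
    · exact Nat.add_pos_right _ (Finset.card_pos.mpr ⟨e, by simp [he, h]⟩)
  obtain ⟨h₁, h₂⟩ | ⟨h₁, h₂⟩ :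
      (#{e ∈ S | src e = v} = 0 ∧ #{e ∈ S | tgt e = v} = 1) ∨
      (#{e ∈ S | src e = v} = 1 ∧ #{e ∈ S | tgt e = v} = 0) := by omega
  · exact key' tgt h₂ (by simpa only [sub_sub_cancel] using sub_mem (key src h₁) hv)
  · exact key' src h₁ (by simpa only [sub_add_cancel] using add_mem hv (key tgt h₂))

/-- A nonempty edge set in which all occurring degrees are at least two supports a nonzero
circulation. -/
theorem exists_circulation [Fintype V] {S : Finset ι} (hS : S.Nonempty)
    (hdeg : ∀ v, (∃ e ∈ S, src e = v ∨ tgt e = v) →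
      2 ≤ #{e ∈ S | src e = v} + #{e ∈ S | tgt e = v}) :
    ∃ c : ι → ℝ, c ≠ 0 ∧ (∀ e ∉ S, c e = 0) ∧ netflow src tgt c = 0 := by
  classical
  set W : Finset V := S.image src ∪ S.image tgt with hW
  have hsrc : ∀ e ∈ S, src e ∈ W := fun e he =>
    Finset.mem_union_left _ (Finset.mem_image_of_mem _ he)
  have htgt : ∀ e ∈ S, tgt e ∈ W := fun e he =>
    Finset.mem_union_right _ (Finset.mem_image_of_mem _ he)
  have hcard : #W ≤ #S := by
    have h : ∑ _v ∈ W, 2 ≤ ∑ v ∈ W, (#{e ∈ S | src e = v} + #{e ∈ S | tgt e = v}) := by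
      refine Finset.sum_le_sum fun v hv => hdeg v ?_
      simp only [hW, Finset.mem_union, Finset.mem_image] at hv
      grind
    rw [Finset.sum_add_distrib, ← Finset.card_eq_sum_card_fiberwise hsrc,
      ← Finset.card_eq_sum_card_fiberwise htgt, Finset.sum_const, smul_eq_mul] at h
    omega
  obtain ⟨e₀, he₀⟩ := hS
  set ext : (S → ℝ) →ₗ[ℝ] (ι → ℝ) := Function.ExtendByZero.linearMap ℝ (Subtype.val : S → ι)
  have hext : ∀ c (e : S), ext c e = c e := fun c e =>
    Subtype.val_injective.extend_apply c 0 e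
  have hext' : ∀ c, ∀ e ∉ S, ext c e = 0 := fun c e he =>
    Function.extend_apply' (f := (Subtype.val : S → ι)) c (0 : ι → ℝ) e
      (by rintro ⟨x, rfl⟩; exact he x.2)
  set L : (S → ℝ) →ₗ[ℝ] (W.erase (src e₀) → ℝ) :=
    LinearMap.funLeft ℝ ℝ Subtype.val ∘ₗ netflow src tgt ∘ₗ ext
  have hker : L.ker ≠ ⊥ := by
    apply LinearMap.ker_ne_bot_of_finrank_lt
    have := Finset.card_erase_lt_of_mem (hsrc e₀ he₀)
    simp only [Module.finrank_fintype_fun_eq_card, Fintype.card_coe]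
    omega
  obtain ⟨c, hc, hc0⟩ := Submodule.exists_mem_ne_zero_of_ne_bot hker
  have hne : ∀ v, v ≠ src e₀ → netflow src tgt (ext c) v = 0 := by
    intro v hv
    by_cases hvW : v ∈ W
    · exact congrFun hc ⟨v, Finset.mem_erase.mpr ⟨hv, hvW⟩⟩
    · have hz : ∀ p : ι → V, (∀ e ∈ S, p e ∈ W) → ∑ e with p e = v, ext c e = 0 := by
        intro p hp
        refine Finset.sum_eq_zero fun e he => hext' c e fun heS => hvW ?_
        rw [← (Finset.mem_filter.mp he).2]
        exact hp e heS
      rw [netflow_apply, hz src hsrc, hz tgt htgt, sub_zero]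
  refine ⟨ext c, fun h => hc0 ?_, hext' c, ?_⟩
  · funext e
    rw [← hext c e, h]
    rfl
  · funext v
    by_cases hv : v = src e₀
    · have := sum_netflow (src := src) (tgt := tgt) (ext c)
      rwa [Finset.sum_eq_single (src e₀) (fun w _ hw => hne w hw) (by simp), ← hv] at this
    · exact hne v hv

/-- The functions with the same netflow as `f` which lie between the floor and ceiling of `f`. -/
def roundingPolytope (src tgt : ι → V) (f : ι → ℝ) : Set (ι → ℝ) :=
  Set.Icc (fun e => (⌊f e⌋ : ℝ)) (fun e => (⌈f e⌉ : ℝ)) ∩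
    netflow src tgt ⁻¹' {netflow src tgt f}

theorem isCompact_roundingPolytope (f : ι → ℝ) : IsCompact (roundingPolytope src tgt f) :=
  isCompact_Icc.inter_right
    (isClosed_singleton.preimage (netflow src tgt).continuous_on_pi)

theorem convex_roundingPolytope (f : ι → ℝ) : Convex ℝ (roundingPolytope src tgt f) :=
  (convex_Icc _ _).inter ((convex_singleton _).linear_preimage _)

theorem exists_pos_add_mem_roundingPolytope {f g c : ι → ℝ} (hg : g ∈ roundingPolytope src tgt f)
    (hc : ∀ e, g e ∈ realInts → c e = 0) (hc' : netflow src tgt c = 0) :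
    ∃ ε > (0 : ℝ), g + ε • c ∈ roundingPolytope src tgt f ∧
      g - ε • c ∈ roundingPolytope src tgt f := by
  obtain ⟨⟨hlo, hhi⟩, hnet⟩ := hg
  have hev : ∀ᶠ ε : ℝ in nhds 0, ∀ e, (⌊f e⌋ : ℝ) ≤ g e + ε * c e ∧ g e + ε * c e ≤ ⌈f e⌉ ∧
      (⌊f e⌋ : ℝ) ≤ g e - ε * c e ∧ g e - ε * c e ≤ ⌈f e⌉ := by
    refine Filter.eventually_all.mpr fun e => ?_
    by_cases he : g e ∈ realInts
    · simp only [hc e he, mul_zero, add_zero, sub_zero]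
      exact Filter.Eventually.of_forall fun _ => ⟨hlo e, hhi e, hlo e, hhi e⟩
    · have h₁ : (⌊f e⌋ : ℝ) < g e := lt_of_le_of_ne (hlo e) fun h => he ⟨_, h⟩
      have h₂ : g e < ⌈f e⌉ := lt_of_le_of_ne (hhi e) fun h => he ⟨_, h.symm⟩
      have hp : Filter.Tendsto (fun ε : ℝ => g e + ε * c e) (nhds 0) (nhds (g e)) :=
        Continuous.tendsto' (by fun_prop) _ _ (by simp)
      have hm : Filter.Tendsto (fun ε : ℝ => g e - ε * c e) (nhds 0) (nhds (g e)) :=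
        Continuous.tendsto' (by fun_prop) _ _ (by simp)
      filter_upwards [hp.eventually_const_lt h₁, hp.eventually_lt_const h₂,
        hm.eventually_const_lt h₁, hm.eventually_lt_const h₂] with ε a b c d
      exact ⟨a.le, b.le, c.le, d.le⟩
  obtain ⟨ε, hε, hpos⟩ :=
    ((hev.filter_mono (nhdsWithin_le_nhds (s := Set.Ioi 0))).and self_mem_nhdsWithin).exists
  refine ⟨ε, hpos, ⟨⟨fun e => (hε e).1, fun e => (hε e).2.1⟩, ?_⟩,
    ⟨⟨fun e => (hε e).2.2.1, fun e => (hε e).2.2.2⟩, ?_⟩⟩ <;>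
  simpa [hc'] using hnet

theorem mem_realInts_of_mem_extremePoints [Fintype V] {f g : ι → ℝ}
    (hf : ∀ v, netflow src tgt f v ∈ realInts)
    (hg : g ∈ (roundingPolytope src tgt f).extremePoints ℝ) (e : ι) : g e ∈ realInts := by
  classical
  by_contra he
  set S : Finset ι := {e | g e ∉ realInts}
  have hS : ∀ e, e ∈ S ↔ g e ∉ realInts := by simp [S]
  obtain ⟨c, hc0, hcS, hc⟩ := exists_circulation (src := src) (tgt := tgt) ⟨e, (hS e).mpr he⟩
    fun v => two_le_degree_of_netflow_mem hS (hg.1.2.symm ▸ hf v)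
  obtain ⟨ε, hε, hp, hm⟩ := exists_pos_add_mem_roundingPolytope hg.1
    (fun e he => hcS e fun h => (hS e).mp h he) hc
  have hseg : g ∈ openSegment ℝ (g + ε • c) (g - ε • c) :=
    ⟨1 / 2, 1 / 2, by norm_num, by norm_num, by norm_num, by module⟩
  have := hg.2 hp hm hseg
  simp [hε.ne', hc0] at this

/-- A function on the edges with integral netflow is a convex combination of integral functions
with the same netflow which round it. -/
theorem mem_convexHull_integral_roundingPolytope [Fintype V] {f : ι → ℝ}
    (hf : ∀ v, netflow src tgt f v ∈ realInts) :
    f ∈ convexHull ℝ {g ∈ roundingPolytope src tgt f | ∀ e, g e ∈ realInts} := by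
  have hfin : {g ∈ roundingPolytope src tgt f | ∀ e, g e ∈ realInts}.Finite := by
    classical
    refine ((Set.finite_Icc (fun e => ⌊f e⌋) (fun e => ⌈f e⌉)).image
      fun z e => (z e : ℝ)).subset ?_
    rintro g ⟨⟨⟨hlo, hhi⟩, -⟩, hint⟩
    choose z hz using hint
    simp only [Int.coe_castAddHom] at hz
    refine ⟨z, ⟨fun e => ?_, fun e => ?_⟩, funext hz⟩
    · exact Int.cast_le.mp ((hlo e).trans_eq (hz e).symm)
    · exact Int.cast_le.mp ((hz e).trans_le (hhi e))
  have hmem : f ∈ roundingPolytope src tgt f :=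
    ⟨⟨fun e => Int.floor_le _, fun e => Int.le_ceil _⟩, rfl⟩
  rw [← closure_convexHull_extremePoints (isCompact_roundingPolytope f)
    (convex_roundingPolytope f)] at hmem
  refine closure_minimal (convexHull_mono fun g hg => ?_)
    (hfin.isClosed_convexHull ℝ) hmem
  exact ⟨hg.1, mem_realInts_of_mem_extremePoints hf hg⟩

end Integrality

section Augmented

variable {n : ℕ} {G : Finset (Fin (n + 1) × Fin (n + 1))}

/-- The inclusion of the edges of `H_G` into those of `G^aug`. -/
def edgeAugOfH (n : ℕ) (G : Finset (Fin (n + 1) × Fin (n + 1))) :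
    (↥(EG0 n G) ⊕ Fin n) → (Fin n ⊕ ↥(EG0 n G) ⊕ ↥(EG0 n G))
  | Sum.inl e => Sum.inr (Sum.inl e)
  | Sum.inr i => Sum.inl i

theorem bGF_mem_realInts (F : Finset (Fin (n + 1) × Fin (n + 1))) (v : Option (Fin (n + 1))) :
    bGF n G F v ∈ realInts := by
  have hnat : ∀ k : ℕ, (k : ℝ) ∈ realInts := fun k => ⟨k, by simp⟩
  match v with
  | none => exact neg_mem (sub_mem (hnat _) (hnat _))
  | some v =>
    simp only [bGF]
    split_ifs
    · exact zero_mem _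
    · exact sub_mem (hnat _) (hnat _)

theorem sum_EG0_indicator {F : Finset (Fin (n + 1) × Fin (n + 1))} (hF : F ⊆ EG0 n G)
    (p : Fin (n + 1) × Fin (n + 1) → Prop) [DecidablePred p] :
    (∑ e : EG0 n G, if p e then (if (e : Fin (n + 1) × Fin (n + 1)) ∈ F then (1 : ℝ) else 0) else 0)
      = #(F.filter p) := by
  rw [Finset.sum_coe_sort (EG0 n G) fun e => if p e then (if e ∈ F then (1 : ℝ) else 0) else 0]
  simp only [← ite_and]
  rw [Finset.sum_boole]
  congr 2
  grind

/-- If the `y`-part of `g` is the indicator of `F`, then passing from `G^aug` to `H_G` changes the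
netflow from `b_G^∅` to `b_G^F`. -/
theorem netflow_aug_eq_iff {F : Finset (Fin (n + 1) × Fin (n + 1))} (hF : F ⊆ EG0 n G)
    {g : (Fin n ⊕ ↥(EG0 n G) ⊕ ↥(EG0 n G)) → ℝ}
    (hg : ∀ e : EG0 n G, g (Sum.inr (Sum.inr e)) = if e.1 ∈ F then 1 else 0) :
    netflow (srcAug n G) (tgtAug n G) g = bGF n G ∅ ↔
      netflow (srcH n G) (tgtH n G) (g ∘ edgeAugOfH n G) = bGF n G F := by
  simp only [funext_iff]
  refine forall_congr' fun v => ?_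
  match v with
  | none =>
    have := sum_EG0_indicator hF fun _ => True
    simp only [if_true, Finset.filter_true] at this
    simp only [netflow, LinearMap.coe_mk, AddHom.coe_mk, Fintype.sum_sum_type, srcAug, tgtAug,
      srcH, tgtH, edgeAugOfH, Function.comp, hg, bGF, reduceCtorEq, if_false, if_true, this,
      Finset.sum_const_zero, Finset.card_empty]
    push_cast
    constructor <;> intro h <;> linarith
  | some v =>
    have := sum_EG0_indicator hF fun e => e.1 = v
    have h0 : v = 0 → #(F.filter fun e => e.1 = v) = 0 := by
      rintro rfl
      rw [Finset.card_eq_zero, Finset.filter_eq_empty_iff]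
      intro e he h
      exact (Finset.mem_filter.mp (hF he)).2 (by simp [h])
    simp only [netflow, LinearMap.coe_mk, AddHom.coe_mk, Fintype.sum_sum_type, srcAug, tgtAug,
      srcH, tgtH, edgeAugOfH, Function.comp, hg, bGF, reduceCtorEq, if_false, this,
      Finset.sum_const_zero, outdeg, Option.some.injEq, Finset.filter_empty, Finset.card_empty]
    split_ifs with hv
    · rw [h0 hv]
      push_cast
      constructor <;> intro h <;> linarith
    · push_cast
      constructor <;> intro h <;> linarith

/-- The union of the sets `S_F` is the set of projections of integral points of the capacitated
flow polytope. -/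
theorem iUnion_ldSet_eq_image :
    (⋃ F ∈ (EG0 n G).powerset, ldSet n G F) =
      (LinearMap.funLeft ℝ ℝ Sum.inl) '' {g ∈ capAug n G | ∀ e, g e ∈ realInts} := by
  ext x
  simp only [Set.mem_iUnion, Finset.mem_powerset, exists_prop]
  constructor
  · rintro ⟨F, hF, f, hf, hint, rfl⟩
    rw [mem_flowPolytope_iff] at hf
    set g : (Fin n ⊕ ↥(EG0 n G) ⊕ ↥(EG0 n G)) → ℝ :=
      Sum.elim (fun i => f (Sum.inr i))
        (Sum.elim (fun e => f (Sum.inl e)) fun e => if e.1 ∈ F then 1 else 0) with hg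
    have hgf : g ∘ edgeAugOfH n G = f := by
      funext e
      rcases e with e | i <;> rfl
    refine ⟨g, ⟨⟨mem_flowPolytope_iff.mpr ⟨?_, (netflow_aug_eq_iff hF fun e => rfl).mpr ?_⟩,
      fun e => ?_⟩, ?_⟩, rfl⟩
    · rintro (i | e | e)
      · exact hf.1 _
      · exact hf.1 _
      · simp only [hg, Sum.elim_inr]
        split_ifs <;> norm_num
    · rw [hgf, hf.2]
    · simp only [hg, Sum.elim_inr]
      split_ifs <;> norm_num
    · have hint' : ∀ e, f e ∈ realInts := fun e => (hint e).imp fun z hz => hz.symm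
      rintro (i | e | e)
      · exact hint' _
      · exact hint' _
      · simp only [hg, Sum.elim_inr]
        split_ifs
        · exact ⟨1, by simp⟩
        · exact zero_mem _
  · rintro ⟨g, ⟨⟨hg, hcap⟩, hint⟩, rfl⟩
    rw [mem_flowPolytope_iff] at hg
    set F : Finset (Fin (n + 1) × Fin (n + 1)) :=
      ((Finset.univ : Finset (EG0 n G)).filter fun e => g (Sum.inr (Sum.inr e)) = 1).map
        (Function.Embedding.subtype _) with hFdef
    have hF : F ⊆ EG0 n G := by
      intro e he
      simp only [hFdef, Finset.mem_map] at he
      obtain ⟨e', -, rfl⟩ := he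
      exact e'.2
    have hgF : ∀ e : EG0 n G, g (Sum.inr (Sum.inr e)) = if e.1 ∈ F then 1 else 0 := by
      intro e
      have hmem : e.1 ∈ F ↔ g (Sum.inr (Sum.inr e)) = 1 := by
        simp [hFdef]
      split_ifs with h
      · exact hmem.mp h
      · rw [hmem] at h
        obtain ⟨z, hz⟩ := hint (Sum.inr (Sum.inr e))
        have h0 := hg.1 (Sum.inr (Sum.inr e))
        have h1 := hcap e
        simp only [Int.coe_castAddHom] at hz
        rw [← hz] at h h0 h1 ⊢
        have h0' : 0 ≤ z := by exact_mod_cast h0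
        have h1' : z ≤ 1 := by exact_mod_cast h1
        have h' : z ≠ 1 := by exact_mod_cast h
        exact_mod_cast (by omega : z = 0)
    exact ⟨F, hF, g ∘ edgeAugOfH n G,
      mem_flowPolytope_iff.mpr ⟨fun e => hg.1 _, (netflow_aug_eq_iff hF hgF).mp hg.2⟩,
      fun e => (hint _).imp fun z hz => hz.symm, rfl⟩

theorem convex_capAug : Convex ℝ (capAug n G) := by
  rintro f ⟨hf, hf1⟩ g ⟨hg, hg1⟩ a b ha hb hab
  rw [mem_flowPolytope_iff] at hf hg
  refine ⟨mem_flowPolytope_iff.mpr ⟨fun e => ?_, ?_⟩, fun e => ?_⟩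
  · exact add_nonneg (mul_nonneg ha (hf.1 e)) (mul_nonneg hb (hg.1 e))
  · rw [map_add, map_smul, map_smul, hf.2, hg.2, Convex.combo_self hab]
  · exact (convex_Iic (1 : ℝ)) (hf1 e) (hg1 e) ha hb hab

theorem roundingPolytope_subset_capAug {f : (Fin n ⊕ ↥(EG0 n G) ⊕ ↥(EG0 n G)) → ℝ}
    (hf : f ∈ capAug n G) :
    roundingPolytope (srcAug n G) (tgtAug n G) f ⊆ capAug n G := by
  obtain ⟨hflow, hcap⟩ := hf
  rw [mem_flowPolytope_iff] at hflow
  rintro g ⟨⟨hlo, hhi⟩, hnet⟩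
  refine ⟨mem_flowPolytope_iff.mpr ⟨fun e => ?_, hnet.trans hflow.2⟩, fun e => ?_⟩
  · exact le_trans (Int.cast_nonneg (Int.floor_nonneg.mpr (hflow.1 e))) (hlo e)
  · have hceil : ⌈f (Sum.inr (Sum.inr e))⌉ ≤ 1 := Int.ceil_le.mpr (by exact_mod_cast hcap e)
    exact (hhi (Sum.inr (Sum.inr e))).trans
      ((Int.cast_le.mpr hceil).trans_eq Int.cast_one)

theorem mem_convexHull_integral_of_mem_capAug {f : (Fin n ⊕ ↥(EG0 n G) ⊕ ↥(EG0 n G)) → ℝ}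
    (hf : f ∈ capAug n G) :
    f ∈ convexHull ℝ {g ∈ roundingPolytope (srcAug n G) (tgtAug n G) f |
      ∀ e, g e ∈ realInts} :=
  mem_convexHull_integral_roundingPolytope fun v => by
    rw [(mem_flowPolytope_iff.mp hf.1).2]
    exact bGF_mem_realInts _ v

end Augmented

/-- Theorem: the Newton polytope of the left-degree polynomial.  For a
simple graph `G` on `[0,n]`, the projection `φ(P^c)` of the capacitated flow polytope of
`G^aug` onto the `a`-edges equals the convex hull of `⋃_{F ⊆ E(G\0)} S_F`, and every
integer point of `φ(P^c)` lies in this union.  (Equivalently, the left-degree polynomial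
`L_G` has polytopal support and `φ(P^c)` is its Newton polytope.) -/
theorem newton_leftDegree (n : ℕ) (G : Finset (Fin (n + 1) × Fin (n + 1)))
    (hG : ∀ e ∈ G, e.1 < e.2) :
    (fun f : (Fin n ⊕ ↥(EG0 n G) ⊕ ↥(EG0 n G)) → ℝ => fun i : Fin n => f (Sum.inl i)) ''
        capAug n G =
      convexHull ℝ (⋃ F ∈ (EG0 n G).powerset, ldSet n G F) ∧
    ∀ x ∈ (fun f : (Fin n ⊕ ↥(EG0 n G) ⊕ ↥(EG0 n G)) → ℝ =>
        fun i : Fin n => f (Sum.inl i)) '' capAug n G,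
      (∀ i, ∃ z : ℤ, x i = (z : ℝ)) → x ∈ ⋃ F ∈ (EG0 n G).powerset, ldSet n G F := by
  change LinearMap.funLeft ℝ ℝ Sum.inl '' capAug n G = _ ∧
    ∀ x ∈ LinearMap.funLeft ℝ ℝ Sum.inl '' capAug n G, _
  rw [iUnion_ldSet_eq_image]
  refine ⟨Set.Subset.antisymm ?_ ?_, ?_⟩
  · rw [← LinearMap.image_convexHull]
    refine Set.image_mono fun f hf => ?_
    refine convexHull_mono ?_ (mem_convexHull_integral_of_mem_capAug hf)
    exact fun g hg => ⟨roundingPolytope_subset_capAug hf hg.1, hg.2⟩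
  · exact convexHull_min (Set.image_mono fun f hf => hf.1) (convex_capAug.linear_image _)
  · rintro _ ⟨f, hf, rfl⟩ hint
    obtain ⟨g, hg, hgint⟩ := convexHull_nonempty_iff.mp
      (Set.nonempty_of_mem (mem_convexHull_integral_of_mem_capAug hf))
    refine ⟨g, ⟨roundingPolytope_subset_capAug hf hg, hgint⟩, funext fun i => ?_⟩
    obtain ⟨z, hfz⟩ : ∃ z : ℤ, f (Sum.inl i) = z := hint i
    have hlo := hg.1.1 (Sum.inl i)
    have hhi := hg.1.2 (Sum.inl i)
    simp only [hfz, Int.floor_intCast, Int.ceil_intCast] at hlo hhi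
    exact (le_antisymm hhi hlo).trans hfz.symm
end
end

section
/- Let G be a simple graph on [0,n] and k ≥ 0. Let P^c_k be the capacitated flow polytope of the graph G^(k) with netflow b_G^(k) = (indeg_G(1), ..., indeg_G(n), −k, k−#E(G)), i.e., the set of flows on G^(k) with this netflow satisfying 0 ≤ f(y_{(j,i)}) ≤ 1 for every y-edge, and let φ send such a flow f to (f(a_1),...,f(a_n)) ∈ ℝ^n. For each F ⊆ E(G\0), let S_F = { ψ(g) : g an integral flow on H_G with netflow b_G^F }. Then φ(P^c_k) equals the convex hull of ∪_{F ⊆ E(G\0), #F = k} S_F, and every integer point of φ(P^c_k) lies in this union; in particular, every integer point of φ(P^c_k) is a left-degree sequence of G whose coordinates sum to #E(G) − k, and the homogeneous component L_G^k of the left-degree polynomial has polytopal support. -/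
noncomputable section

open Finset

/-- Source map of the graph `G^(k)` on the vertex set `[n+1] ∪ {t}` (modeled as
`Option (Fin (n+2))` with `none = t` and `some (n+1)` the extra vertex `n+1`; the vertex
`some 0` is unused).  Its edges are: one edge `a_j : j → t` for each `j ∈ [n]`, one edge
`z_{(j,i)} : j → i` for each `(j,i) ∈ E(G\0)`, and one edge `y_{(j,i)} : j → n+1` for
each `(j,i) ∈ E(G\0)`. -/
def srcK (n : ℕ) (G : Finset (Fin (n + 1) × Fin (n + 1))) :
    (Fin n ⊕ ↥(EG0 n G) ⊕ ↥(EG0 n G)) → Option (Fin (n + 2))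
  | Sum.inl j => some j.succ.castSucc
  | Sum.inr (Sum.inl e) => some e.1.1.castSucc
  | Sum.inr (Sum.inr e) => some e.1.1.castSucc

/-- Target map of `G^(k)`. -/
def tgtK (n : ℕ) (G : Finset (Fin (n + 1) × Fin (n + 1))) :
    (Fin n ⊕ ↥(EG0 n G) ⊕ ↥(EG0 n G)) → Option (Fin (n + 2))
  | Sum.inl _ => none
  | Sum.inr (Sum.inl e) => some e.1.2.castSucc
  | Sum.inr (Sum.inr _) => some (Fin.last (n + 1))

/-- The netflow vector `b_G^(k) = (indeg_G(1), …, indeg_G(n), −k, k − #E(G))` on the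
vertices of `G^(k)`. -/
def bK (n : ℕ) (G : Finset (Fin (n + 1) × Fin (n + 1))) (k : ℕ) :
    Option (Fin (n + 2)) → ℝ
  | none => (k : ℝ) - (G.card : ℝ)
  | some v =>
      if (v : ℕ) = n + 1 then -(k : ℝ)
      else if (v : ℕ) = 0 then 0
      else ((G.filter fun e => (e.2 : ℕ) = (v : ℕ)).card : ℝ)

/-- The capacitated flow polytope `P^c_k` of `G^(k)` with netflow `b_G^(k)` and
capacities `0 ≤ f ≤ 1` on the `y`-edges. -/
def capK (n : ℕ) (G : Finset (Fin (n + 1) × Fin (n + 1))) (k : ℕ) :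
    Set ((Fin n ⊕ ↥(EG0 n G) ⊕ ↥(EG0 n G)) → ℝ) :=
  {f | f ∈ flowPolytope (srcK n G) (tgtK n G) (bK n G k) ∧
    ∀ e : ↥(EG0 n G), f (Sum.inr (Sum.inr e)) ≤ 1}

/-- The netflow of a real-valued edge function, as a linear map. -/
def netflowMap {V ι : Type*} [Fintype ι] [DecidableEq V] (src tgt : ι → V) :
    (ι → ℝ) →ₗ[ℝ] (V → ℝ) where
  toFun f v := (∑ e, if src e = v then f e else 0) - ∑ e, if tgt e = v then f e else 0
  map_add' f g := by
    ext v
    simp only [Pi.add_apply, ← sum_sub_distrib, ← sum_add_distrib]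
    refine sum_congr rfl fun e _ => ?_
    split_ifs <;> ring
  map_smul' c f := by
    ext v
    simp only [Pi.smul_apply, smul_eq_mul, RingHom.id_apply, ← sum_sub_distrib, mul_sum]
    refine sum_congr rfl fun e _ => ?_
    split_ifs <;> ring

theorem netflowMap_apply {V ι : Type*} [Fintype ι] [DecidableEq V] (src tgt : ι → V)
    (f : ι → ℝ) (v : V) :
    netflowMap src tgt f v =
      (∑ e, if src e = v then f e else 0) - ∑ e, if tgt e = v then f e else 0 := rfl

theorem sum_netflowMap {V ι : Type*} [Fintype ι] [Fintype V] [DecidableEq V] (src tgt : ι → V)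
    (f : ι → ℝ) : ∑ v, netflowMap src tgt f v = 0 := by
  simp only [netflowMap_apply, sum_sub_distrib]
  rw [sum_comm, sum_comm (f := fun v e => if tgt e = v then f e else 0)]
  simp

open Classical in
/-- The edges on which `f` is not an integer. -/
def fracSupport {ι : Type*} [Fintype ι] (f : ι → ℝ) : Finset ι :=
  univ.filter fun e => ¬ ∃ z : ℤ, f e = z

theorem mem_fracSupport {ι : Type*} [Fintype ι] {f : ι → ℝ} {e : ι} :
    e ∈ fracSupport f ↔ ¬ ∃ z : ℤ, f e = z := by
  simp [fracSupport]

/-- If the netflow at `v` is an integer, then `v` is not incident to exactly one edge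
carrying a non-integer value. -/
theorem exists_ne_incident_fracSupport {V ι : Type*} [Fintype ι] [DecidableEq V]
    {src tgt : ι → V} (hne : ∀ e, src e ≠ tgt e) {f : ι → ℝ} {v : V}
    (hv : ∃ z : ℤ, netflowMap src tgt f v = z) {e : ι} (he : e ∈ fracSupport f)
    (hev : src e = v ∨ tgt e = v) :
    ∃ e' ∈ fracSupport f, (src e' = v ∨ tgt e' = v) ∧ e' ≠ e := by
  classical
  by_contra! H
  have hint : ∀ e', e' ≠ e → (src e' = v ∨ tgt e' = v) → ∃ z : ℤ, f e' = z := by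
    intro e' h1 h2
    by_contra h3
    exact h1 (H e' (mem_fracSupport.2 h3) h2)
  obtain ⟨z, hz⟩ := hv
  rw [netflowMap_apply, ← sum_sub_distrib, ← add_sum_erase _ _ (mem_univ e)] at hz
  have hrest : (∑ e' ∈ univ.erase e, ((if src e' = v then f e' else 0) -
      if tgt e' = v then f e' else 0)) ∈ (Int.castAddHom ℝ).range := by
    refine AddSubgroup.sum_mem _ fun e' he' => ?_
    have hmem : (src e' = v ∨ tgt e' = v) → f e' ∈ (Int.castAddHom ℝ).range := fun h => by
      obtain ⟨w, hw⟩ := hint e' (ne_of_mem_erase he') h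
      exact ⟨w, hw.symm⟩
    refine AddSubgroup.sub_mem _ ?_ ?_
    · split_ifs with h
      · exact hmem (Or.inl h)
      · exact AddSubgroup.zero_mem _
    · split_ifs with h
      · exact hmem (Or.inr h)
      · exact AddSubgroup.zero_mem _
  obtain ⟨w, hw⟩ := hrest
  rw [← hw] at hz
  simp only [Int.coe_castAddHom] at hz
  apply mem_fracSupport.1 he
  rcases hev with h | h
  · have h' : tgt e ≠ v := fun h' => hne e (h.trans h'.symm)
    refine ⟨z - w, ?_⟩
    rw [if_pos h, if_neg h'] at hz
    push_cast
    linarith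
  · have h' : src e ≠ v := fun h' => hne e (h'.trans h.symm)
    refine ⟨w - z, ?_⟩
    rw [if_pos h, if_neg h'] at hz
    push_cast
    linarith

/-- A non-integral function with integral netflow admits a nonzero circulation supported on
its non-integral edges. -/
theorem exists_circulation_fracSupport {V ι : Type*} [Fintype ι] [Fintype V] [DecidableEq V]
    {src tgt : ι → V} (hne : ∀ e, src e ≠ tgt e) {f : ι → ℝ}
    (hf : ∀ v, ∃ z : ℤ, netflowMap src tgt f v = z) (hS : (fracSupport f).Nonempty) :
    ∃ d : ι → ℝ, d ≠ 0 ∧ netflowMap src tgt d = 0 ∧ ∀ e ∉ fracSupport f, d e = 0 := by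
  classical
  set S := fracSupport f
  let W : Finset V := univ.filter fun v => ∃ e ∈ S, src e = v ∨ tgt e = v
  have hcard : W.card * 2 ≤ S.card * 2 := by
    refine card_mul_le_card_mul (fun v e => src e = v ∨ tgt e = v) ?_ ?_
    · intro v hv
      obtain ⟨e, he, hev⟩ := (mem_filter.1 hv).2
      obtain ⟨e', he', hev', hee'⟩ := exists_ne_incident_fracSupport hne (hf v) he hev
      exact one_lt_card.2 ⟨e', by simp [bipartiteAbove, S, he', hev'], e,
        by simp [bipartiteAbove, S, he, hev], hee'⟩
    · intro e _
      refine (card_le_card (t := {src e, tgt e}) fun v hv => ?_).trans card_le_two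
      have := (mem_filter.1 hv).2
      simp only [mem_insert, mem_singleton]
      tauto
  obtain ⟨e₀, he₀⟩ := hS
  have hv₀ : src e₀ ∈ W := mem_filter.2 ⟨mem_univ _, e₀, he₀, Or.inl rfl⟩
  let L : (ι → ℝ) →ₗ[ℝ] (↥(W.erase (src e₀)) → ℝ) × (↥(Sᶜ) → ℝ) :=
    ((LinearMap.funLeft ℝ ℝ Subtype.val).comp (netflowMap src tgt)).prod
      (LinearMap.funLeft ℝ ℝ Subtype.val)
  have hlt : Module.finrank ℝ ((↥(W.erase (src e₀)) → ℝ) × (↥(Sᶜ) → ℝ)) <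
      Module.finrank ℝ (ι → ℝ) := by
    rw [Module.finrank_prod, Module.finrank_fintype_fun_eq_card,
      Module.finrank_fintype_fun_eq_card, Module.finrank_fintype_fun_eq_card,
      Fintype.card_coe, Fintype.card_coe, card_erase_of_mem hv₀]
    have h1 := card_add_card_compl S
    have h2 := card_pos.2 ⟨_, hv₀⟩
    omega
  obtain ⟨d, hd, hd0⟩ := (Submodule.ne_bot_iff _).1
    (LinearMap.ker_ne_bot_of_finrank_lt (f := L) hlt)
  rw [LinearMap.mem_ker, Prod.ext_iff] at hd
  have hdS : ∀ e ∉ S, d e = 0 := fun e he => congrFun hd.2 ⟨e, mem_compl.2 he⟩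
  have hdv : ∀ v, v ≠ src e₀ → netflowMap src tgt d v = 0 := by
    intro v hv
    by_cases hvW : v ∈ W
    · exact congrFun hd.1 ⟨v, mem_erase.2 ⟨hv, hvW⟩⟩
    · have h0 : ∀ e, src e = v ∨ tgt e = v → d e = 0 := fun e he =>
        hdS e fun heS => hvW (mem_filter.2 ⟨mem_univ _, e, heS, he⟩)
      rw [netflowMap_apply, sum_eq_zero, sum_eq_zero, sub_zero]
      · intro e _
        split_ifs with h
        exacts [h0 e (Or.inr h), rfl]
      · intro e _
        split_ifs with h
        exacts [h0 e (Or.inl h), rfl]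
  refine ⟨d, hd0, funext fun v => ?_, hdS⟩
  by_cases hv : v = src e₀
  · have := sum_netflowMap src tgt d
    rwa [sum_eq_single (src e₀) (fun v _ h => hdv v h) (by simp), ← hv] at this
  · exact hdv v hv

/-- Moving from `f` in a direction supported on its non-integral coordinates until a further
coordinate becomes an integer. -/
theorem exists_pos_fracSupport_ssubset {ι : Type*} [Fintype ι] {f d : ι → ℝ} (hd : d ≠ 0)
    (hdS : ∀ e ∉ fracSupport f, d e = 0) :
    ∃ t : ℝ, 0 < t ∧ fracSupport (f + t • d) ⊂ fracSupport f ∧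
      ∀ e, (⌊f e⌋ : ℝ) ≤ (f + t • d) e ∧ (f + t • d) e ≤ ⌈f e⌉ := by
  classical
  let τ : ι → ℝ := fun e => if 0 < d e then (⌈f e⌉ - f e) / d e else (⌊f e⌋ - f e) / d e
  obtain ⟨e₁, he₁⟩ := Function.ne_iff.1 hd
  obtain ⟨e₀, he₀, hmin⟩ := exists_min_image (univ.filter fun e => d e ≠ 0) τ
    ⟨e₁, mem_filter.2 ⟨mem_univ _, he₁⟩⟩
  have he₀' : d e₀ ≠ 0 := (mem_filter.1 he₀).2
  have hfrac : ∀ e, d e ≠ 0 → e ∈ fracSupport f := fun e he => by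
    by_contra h
    exact he (hdS e h)
  have hlo : ∀ e, d e ≠ 0 → (⌊f e⌋ : ℝ) < f e := fun e he =>
    lt_of_le_of_ne (Int.floor_le _) fun h => mem_fracSupport.1 (hfrac e he) ⟨_, h.symm⟩
  have hhi : ∀ e, d e ≠ 0 → f e < ⌈f e⌉ := fun e he =>
    lt_of_le_of_ne (Int.le_ceil _) fun h => mem_fracSupport.1 (hfrac e he) ⟨_, h⟩
  have hτ : ∀ e, d e ≠ 0 → 0 < τ e := by
    intro e he
    by_cases h : 0 < d e
    · simp only [τ, if_pos h]
      exact div_pos (sub_pos.2 (hhi e he)) h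
    · simp only [τ, if_neg h]
      exact div_pos_of_neg_of_neg (sub_neg.2 (hlo e he)) (lt_of_le_of_ne (not_lt.1 h) he)
  have hpos := hτ e₀ he₀'
  refine ⟨τ e₀, hpos, ?_, ?_⟩
  · refine (ssubset_iff_of_subset fun e he => ?_).2 ⟨e₀, hfrac e₀ he₀', ?_⟩
    · by_contra h
      rw [mem_fracSupport, Pi.add_apply, Pi.smul_apply, hdS e h, smul_zero, add_zero] at he
      exact h (mem_fracSupport.2 he)
    · rw [mem_fracSupport, not_not, Pi.add_apply, Pi.smul_apply, smul_eq_mul]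
      by_cases h : 0 < d e₀
      · refine ⟨⌈f e₀⌉, ?_⟩
        simp only [τ, if_pos h]
        field_simp
        ring
      · refine ⟨⌊f e₀⌋, ?_⟩
        simp only [τ, if_neg h]
        field_simp
        ring
  · intro e
    simp only [Pi.add_apply, Pi.smul_apply, smul_eq_mul]
    have h1 := Int.floor_le (f e)
    have h2 := Int.le_ceil (f e)
    rcases lt_trichotomy (d e) 0 with h | h | h
    · have hle := hmin e (mem_filter.2 ⟨mem_univ _, h.ne⟩)
      rw [show τ e = (⌊f e⌋ - f e) / d e from if_neg h.le.not_gt, le_div_iff_of_neg h] at hle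
      have := mul_neg_of_pos_of_neg hpos h
      constructor <;> linarith
    · rw [h, mul_zero, add_zero]
      exact ⟨h1, h2⟩
    · have hle := hmin e (mem_filter.2 ⟨mem_univ _, h.ne'⟩)
      rw [show τ e = (⌈f e⌉ - f e) / d e from if_pos h, le_div_iff₀ h] at hle
      have := mul_pos hpos h
      constructor <;> linarith

/-- Integral edge functions with the same netflow as `f` obtained by rounding each value
of `f` up or down. -/
def roundings {V ι : Type*} [Fintype ι] [DecidableEq V] (src tgt : ι → V) (f : ι → ℝ) :
    Set (ι → ℝ) :=
  {g | netflowMap src tgt g = netflowMap src tgt f ∧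
    ∀ e, ((⌊f e⌋ : ℝ) ≤ g e ∧ g e ≤ ⌈f e⌉) ∧ ∃ z : ℤ, g e = z}

theorem roundings_subset {V ι : Type*} [Fintype ι] [DecidableEq V] {src tgt : ι → V}
    {f g : ι → ℝ} (hnet : netflowMap src tgt g = netflowMap src tgt f)
    (hg : ∀ e, (⌊f e⌋ : ℝ) ≤ g e ∧ g e ≤ ⌈f e⌉) : roundings src tgt g ⊆ roundings src tgt f := by
  rintro h ⟨h1, h2⟩
  refine ⟨h1.trans hnet, fun e => ⟨⟨?_, ?_⟩, (h2 e).2⟩⟩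
  · exact (Int.cast_le.2 (Int.le_floor.2 (hg e).1)).trans (h2 e).1.1
  · exact (h2 e).1.2.trans (Int.cast_le.2 (Int.ceil_le.2 (hg e).2))

/-- An edge function with integral netflow is a convex combination of its integral roundings. -/
theorem mem_convexHull_roundings {V ι : Type*} [Fintype ι] [Fintype V] [DecidableEq V]
    {src tgt : ι → V} (hne : ∀ e, src e ≠ tgt e) (f : ι → ℝ)
    (hf : ∀ v, ∃ z : ℤ, netflowMap src tgt f v = z) :
    f ∈ convexHull ℝ (roundings src tgt f) := by
  induction hm : (fracSupport f).card using Nat.strong_induction_on generalizing f with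
  | _ m ih =>
  subst hm
  rcases (fracSupport f).eq_empty_or_nonempty with h0 | hS
  · refine subset_convexHull ℝ _ ⟨rfl, fun e => ⟨⟨Int.floor_le _, Int.le_ceil _⟩, ?_⟩⟩
    by_contra h
    exact notMem_empty e (h0 ▸ mem_fracSupport.2 h)
  obtain ⟨d, hd, hnet, hdS⟩ := exists_circulation_fracSupport hne hf hS
  have step : ∀ c : ι → ℝ, netflowMap src tgt c = 0 → ∀ t : ℝ,
      fracSupport (f + t • c) ⊂ fracSupport f →
      (∀ e, (⌊f e⌋ : ℝ) ≤ (f + t • c) e ∧ (f + t • c) e ≤ ⌈f e⌉) →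
      f + t • c ∈ convexHull ℝ (roundings src tgt f) := by
    intro c hc t hlt hbd
    have hnet' : netflowMap src tgt (f + t • c) = netflowMap src tgt f := by
      rw [map_add, map_smul, hc, smul_zero, add_zero]
    exact convexHull_mono (roundings_subset hnet' hbd)
      (ih _ (card_lt_card hlt) _ (by rwa [hnet']) rfl)
  obtain ⟨t, ht, hlt, hbd⟩ := exists_pos_fracSupport_ssubset hd hdS
  obtain ⟨s, hs, hlt', hbd'⟩ := exists_pos_fracSupport_ssubset (d := -d) (neg_ne_zero.2 hd)
    fun e he => by rw [Pi.neg_apply, hdS e he, neg_zero]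
  have hst : 0 < t + s := add_pos ht hs
  have hcomb := (convex_convexHull ℝ (roundings src tgt f))
    (step d hnet t hlt hbd) (step (-d) (by rw [map_neg, hnet, neg_zero]) s hlt' hbd')
    (div_nonneg hs.le hst.le) (div_nonneg ht.le hst.le)
    (by rw [← add_div, add_comm, div_self hst.ne'])
  convert hcomb using 1
  ext e
  simp only [Pi.add_apply, Pi.smul_apply, Pi.neg_apply, smul_eq_mul]
  field_simp
  ring

theorem mem_flowPolytope_srcH {n : ℕ} {G F : Finset (Fin (n + 1) × Fin (n + 1))}
    (hG : ∀ e ∈ G, e.1 < e.2) (f : (↥(EG0 n G) ⊕ Fin n) → ℝ) :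
    f ∈ flowPolytope (srcH n G) (tgtH n G) (bGF n G F) ↔
      (∀ e, 0 ≤ f e) ∧ ∑ i, f (Sum.inr i) = G.card - F.card ∧
      ∀ i : Fin n, (∑ e : ↥(EG0 n G), if e.1.1 = i.succ then f (Sum.inl e) else 0) +
        f (Sum.inr i) - (∑ e : ↥(EG0 n G), if e.1.2 = i.succ then f (Sum.inl e) else 0) =
        indeg n G i.succ - outdeg n F i.succ := by
  have h1 : ∀ e : ↥(EG0 n G), e.1.1 ≠ 0 := fun e h =>
    (mem_filter.1 e.2).2 (by rw [h]; rfl)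
  have h2 : ∀ e : ↥(EG0 n G), e.1.2 ≠ 0 := fun e h => by
    have := hG _ (mem_filter.1 e.2).1
    rw [h] at this
    exact absurd this (Fin.not_lt_zero _)
  simp only [flowPolytope, Set.mem_ofPred_eq, Option.forall, Fin.forall_fin_succ]
  simp [Fintype.sum_sum_type, srcH, tgtH, bGF, h1, h2, Fin.succ_ne_zero]
  intro _ _ _
  constructor <;> intro h <;> linarith

theorem mem_flowPolytope_srcK {n : ℕ} {G : Finset (Fin (n + 1) × Fin (n + 1))}
    (hG : ∀ e ∈ G, e.1 < e.2) (k : ℕ) (f : (Fin n ⊕ ↥(EG0 n G) ⊕ ↥(EG0 n G)) → ℝ) :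
    f ∈ flowPolytope (srcK n G) (tgtK n G) (bK n G k) ↔
      (∀ e, 0 ≤ f e) ∧ ∑ i, f (Sum.inl i) = G.card - k ∧
      ∑ e, f (Sum.inr (Sum.inr e)) = k ∧
      ∀ i : Fin n, f (Sum.inl i) +
        (∑ e : ↥(EG0 n G), if e.1.1 = i.succ then f (Sum.inr (Sum.inl e)) else 0) +
        (∑ e : ↥(EG0 n G), if e.1.1 = i.succ then f (Sum.inr (Sum.inr e)) else 0) -
        (∑ e : ↥(EG0 n G), if e.1.2 = i.succ then f (Sum.inr (Sum.inl e)) else 0) =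
        indeg n G i.succ := by
  have h1 : ∀ e : ↥(EG0 n G), e.1.1 ≠ 0 := fun e h =>
    (mem_filter.1 e.2).2 (by rw [h]; rfl)
  have h2 : ∀ e : ↥(EG0 n G), e.1.2 ≠ 0 := fun e h => by
    have := hG _ (mem_filter.1 e.2).1
    rw [h] at this
    exact absurd this (Fin.not_lt_zero _)
  have h3 : ∀ i : Fin n, #(G.filter fun e => (e.2 : ℕ) = i + 1) = indeg n G i.succ := fun i => by
    simp [indeg, Fin.ext_iff]
  have h4 : ∀ i : Fin n, (i : ℕ) ≠ n := fun i => i.2.ne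
  have h5 : ∀ (v : Fin (n + 1)) (i : Fin n), v.castSucc = i.castSucc.succ ↔ v = i.succ :=
    fun v i => by rw [Fin.succ_castSucc, Fin.castSucc_inj]
  have h6 : ∀ i : Fin n, Fin.last (n + 1) ≠ i.castSucc.succ := fun i => by
    rw [Fin.succ_castSucc]
    exact (Fin.castSucc_ne_last _).symm
  simp only [flowPolytope, Set.mem_ofPred_eq, Option.forall, Fin.forall_fin_succ' (n := n + 1),
    Fin.forall_fin_succ (n := n)]
  simp [Fintype.sum_sum_type, srcK, tgtK, bK, h1, h2, h3, h4, h5, h6, Fin.succ_ne_zero]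
  intro _ _ _
  constructor
  · rintro ⟨ha, hv, hy⟩
    exact ⟨by linarith, hy, fun i => by linarith [hv i]⟩
  · rintro ⟨ha, hy, hv⟩
    exact ⟨by linarith, fun i => by linarith [hv i], hy⟩

theorem sum_ite_mem {n : ℕ} {G F : Finset (Fin (n + 1) × Fin (n + 1))} (hF : F ⊆ EG0 n G) :
    ∑ e : ↥(EG0 n G), (if e.1 ∈ F then (1 : ℝ) else 0) = F.card := by
  rw [sum_coe_sort (EG0 n G) fun e => if e ∈ F then (1 : ℝ) else 0, sum_boole,
    filter_mem_eq_inter, inter_eq_right.2 hF]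

theorem sum_ite_src_ite_mem {n : ℕ} {G F : Finset (Fin (n + 1) × Fin (n + 1))}
    (hF : F ⊆ EG0 n G) (v : Fin (n + 1)) :
    (∑ e : ↥(EG0 n G), if e.1.1 = v then (if e.1 ∈ F then (1 : ℝ) else 0) else 0) =
      outdeg n F v := by
  rw [sum_coe_sort (EG0 n G) fun e => if e.1 = v then (if e ∈ F then (1 : ℝ) else 0) else 0]
  simp only [← ite_and]
  rw [sum_boole, outdeg]
  congr 2
  ext e
  have := @hF e
  simp only [mem_filter]
  tauto

theorem capK_integral_mem_ldSet {n : ℕ} {G : Finset (Fin (n + 1) × Fin (n + 1))}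
    (hG : ∀ e ∈ G, e.1 < e.2) {k : ℕ} {g : (Fin n ⊕ ↥(EG0 n G) ⊕ ↥(EG0 n G)) → ℝ}
    (hg : g ∈ capK n G k) (hint : ∀ e, ∃ z : ℤ, g e = z) :
    (fun i => g (Sum.inl i)) ∈
      ⋃ F ∈ (EG0 n G).powerset.filter (fun F => F.card = k), ldSet n G F := by
  classical
  obtain ⟨hflow, hcap⟩ := hg
  obtain ⟨hnn, hsum, hy, hv⟩ := (mem_flowPolytope_srcK hG k g).1 hflow
  let F := (univ.filter fun e : ↥(EG0 n G) => g (Sum.inr (Sum.inr e)) = 1).map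
    (Function.Embedding.subtype _)
  have hF : F ⊆ EG0 n G := fun e he => by
    obtain ⟨e', -, rfl⟩ := mem_map.1 he
    exact e'.2
  have hmem : ∀ e : ↥(EG0 n G), e.1 ∈ F ↔ g (Sum.inr (Sum.inr e)) = 1 := fun e => by
    simp [F]
  have hgF : ∀ e : ↥(EG0 n G), g (Sum.inr (Sum.inr e)) = if e.1 ∈ F then (1 : ℝ) else 0 := by
    intro e
    split_ifs with h
    · exact (hmem e).1 h
    · rw [hmem] at h
      have h0 := hnn (Sum.inr (Sum.inr e))
      have h1 := hcap e
      obtain ⟨z, hz⟩ := hint (Sum.inr (Sum.inr e))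
      rw [hz] at h h0 h1 ⊢
      norm_cast at h h0 h1 ⊢
      omega
  simp only [hgF, sum_ite_mem hF, sum_ite_src_ite_mem hF] at hy hv
  simp only [Set.mem_iUnion]
  refine ⟨F, mem_filter.2 ⟨mem_powerset.2 hF, by exact_mod_cast hy⟩,
    Sum.elim (fun e => g (Sum.inr (Sum.inl e))) (fun i => g (Sum.inl i)), ?_, ?_, rfl⟩
  · rw [mem_flowPolytope_srcH hG]
    refine ⟨?_, ?_, fun i => ?_⟩
    · rintro (e | i) <;> exact hnn _
    · simp only [Sum.elim_inr, hy, hsum]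
    · simp only [Sum.elim_inr, Sum.elim_inl]
      linarith [hv i]
  · rintro (e | i) <;> exact hint _

theorem ldSet_subset_image_capK {n : ℕ} {G F : Finset (Fin (n + 1) × Fin (n + 1))}
    (hG : ∀ e ∈ G, e.1 < e.2) (hF : F ⊆ EG0 n G) :
    ldSet n G F ⊆ (fun f : (Fin n ⊕ ↥(EG0 n G) ⊕ ↥(EG0 n G)) → ℝ =>
      fun i : Fin n => f (Sum.inl i)) '' capK n G F.card := by
  rintro x ⟨f, hf, -, rfl⟩
  obtain ⟨hnn, hsum, hv⟩ := (mem_flowPolytope_srcH hG f).1 hf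
  refine ⟨Sum.elim (fun i => f (Sum.inr i)) (Sum.elim (fun e => f (Sum.inl e))
    fun e => if e.1 ∈ F then 1 else 0), ⟨?_, fun e => ?_⟩, rfl⟩
  · rw [mem_flowPolytope_srcK hG]
    simp only [Sum.elim_inr, Sum.elim_inl, sum_ite_mem hF, sum_ite_src_ite_mem hF]
    refine ⟨?_, hsum, trivial, fun i => by linarith [hv i]⟩
    rintro (i | e | e)
    · exact hnn _
    · exact hnn _
    · simp only [Sum.elim_inr]
      split_ifs <;> norm_num
  · simp only [Sum.elim_inr]
    split_ifs <;> norm_num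

theorem convex_flowPolytope {V ι : Type*} [Fintype ι] [DecidableEq V] (src tgt : ι → V)
    (a : V → ℝ) : Convex ℝ (flowPolytope src tgt a) := by
  have h : flowPolytope src tgt a = Set.Ici 0 ∩ netflowMap src tgt ⁻¹' {a} := by
    ext f
    exact and_congr Iff.rfl funext_iff.symm
  rw [h]
  exact (convex_Ici 0).inter ((convex_singleton a).linear_preimage _)

theorem convex_capK (n : ℕ) (G : Finset (Fin (n + 1) × Fin (n + 1))) (k : ℕ) :
    Convex ℝ (capK n G k) := by
  refine (convex_flowPolytope _ _ _).inter fun f hf g hg a b ha hb hab e => ?_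
  have h1 := mul_le_mul_of_nonneg_left (hf e) ha
  have h2 := mul_le_mul_of_nonneg_left (hg e) hb
  simp only [Pi.add_apply, Pi.smul_apply, smul_eq_mul]
  linarith

theorem roundings_subset_capK {n : ℕ} {G : Finset (Fin (n + 1) × Fin (n + 1))} {k : ℕ}
    {f : (Fin n ⊕ ↥(EG0 n G) ⊕ ↥(EG0 n G)) → ℝ} (hf : f ∈ capK n G k) :
    roundings (srcK n G) (tgtK n G) f ⊆ capK n G k := by
  rintro g ⟨hnet, hg⟩
  refine ⟨⟨fun e => ?_, fun v => (congrFun hnet v).trans (hf.1.2 v)⟩, fun e => ?_⟩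
  · exact (Int.cast_nonneg (Int.floor_nonneg.2 (hf.1.1 e))).trans (hg e).1.1
  · refine (hg _).1.2.trans ?_
    exact_mod_cast Int.ceil_le.2 (by exact_mod_cast hf.2 e)

theorem mem_convexHull_roundings_of_mem_capK {n : ℕ}
    {G : Finset (Fin (n + 1) × Fin (n + 1))} (hG : ∀ e ∈ G, e.1 < e.2) {k : ℕ}
    {f : (Fin n ⊕ ↥(EG0 n G) ⊕ ↥(EG0 n G)) → ℝ} (hf : f ∈ capK n G k) :
    f ∈ convexHull ℝ (roundings (srcK n G) (tgtK n G) f) := by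
  refine mem_convexHull_roundings ?_ f fun v => ?_
  · rintro (i | e | e) h
    · simp [srcK, tgtK] at h
    · simp only [srcK, tgtK, Option.some.injEq, Fin.castSucc_inj] at h
      exact (hG _ (mem_filter.1 e.2).1).ne h
    · simp only [srcK, tgtK, Option.some.injEq] at h
      exact Fin.castSucc_ne_last _ h
  · rw [show netflowMap _ _ f v = _ from hf.1.2 v]
    cases v with
    | none => exact ⟨k - G.card, by simp [bK]⟩
    | some v =>
      simp only [bK]
      split_ifs
      exacts [⟨-k, by simp⟩, ⟨0, by simp⟩, ⟨_, (Int.cast_natCast _).symm⟩]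

/-- Theorem: Newton polytopes of the homogeneous components of the
left-degree polynomial.  For a simple graph `G` on `[0,n]` and `k ≥ 0`, the projection
`φ(P^c_k)` of the capacitated flow polytope of `G^(k)` onto the `a`-edges equals the
convex hull of `⋃_{F ⊆ E(G\0), #F = k} S_F`, every integer point of `φ(P^c_k)` lies in
this union, and in particular every integer point of `φ(P^c_k)` is a left-degree sequence
of `G` whose coordinates sum to `#E(G) − k` (so `L_G^k` has polytopal support). -/
theorem newton_leftDegree_component (n : ℕ) (G : Finset (Fin (n + 1) × Fin (n + 1)))
    (hG : ∀ e ∈ G, e.1 < e.2) (k : ℕ) :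
    (fun f : (Fin n ⊕ ↥(EG0 n G) ⊕ ↥(EG0 n G)) → ℝ => fun i : Fin n => f (Sum.inl i)) ''
        capK n G k =
      convexHull ℝ (⋃ F ∈ (EG0 n G).powerset.filter (fun F => F.card = k), ldSet n G F) ∧
    (∀ x ∈ (fun f : (Fin n ⊕ ↥(EG0 n G) ⊕ ↥(EG0 n G)) → ℝ =>
        fun i : Fin n => f (Sum.inl i)) '' capK n G k,
      (∀ i, ∃ z : ℤ, x i = (z : ℝ)) →
        x ∈ ⋃ F ∈ (EG0 n G).powerset.filter (fun F => F.card = k), ldSet n G F) ∧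
    (∀ x ∈ (fun f : (Fin n ⊕ ↥(EG0 n G) ⊕ ↥(EG0 n G)) → ℝ =>
        fun i : Fin n => f (Sum.inl i)) '' capK n G k,
      (∀ i, ∃ z : ℤ, x i = (z : ℝ)) → ∑ i, x i = (G.card : ℝ) - (k : ℝ)) := by
  refine ⟨Set.Subset.antisymm ?_ ?_, ?_, ?_⟩
  · rintro _ ⟨f, hf, rfl⟩
    have h := Set.mem_image_of_mem (LinearMap.funLeft ℝ ℝ Sum.inl)
      (mem_convexHull_roundings_of_mem_capK hG hf)
    rw [LinearMap.image_convexHull] at h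
    refine convexHull_mono ?_ h
    rintro _ ⟨g, hg, rfl⟩
    exact capK_integral_mem_ldSet hG (roundings_subset_capK hf hg) fun e => (hg.2 e).2
  · refine convexHull_min ?_
      ((convex_capK n G k).linear_image (LinearMap.funLeft ℝ ℝ Sum.inl))
    refine Set.iUnion₂_subset fun F hF => ?_
    obtain ⟨hFG, rfl⟩ := mem_filter.1 hF
    exact ldSet_subset_image_capK hG (mem_powerset.1 hFG)
  · rintro _ ⟨f, hf, rfl⟩ hint
    obtain ⟨g, hg⟩ := convexHull_nonempty_iff.1 ⟨f, mem_convexHull_roundings_of_mem_capK hG hf⟩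
    have heq : (fun i => f (Sum.inl i)) = fun i => g (Sum.inl i) := by
      ext i
      obtain ⟨z, hz : f (Sum.inl i) = z⟩ := hint i
      have h := (hg.2 (Sum.inl i)).1
      rw [hz, Int.floor_intCast, Int.ceil_intCast] at h
      exact hz.trans (le_antisymm h.1 h.2)
    simp only [heq]
    exact capK_integral_mem_ldSet hG (roundings_subset_capK hf hg) fun e => (hg.2 e).2
  · rintro _ ⟨f, hf, rfl⟩ -
    exact ((mem_flowPolytope_srcK hG k f).1 hf.1).2.1
end
end

section
/- Let G be a simple graph on [0,n] with m = #E(G) edges, and let k ≥ 0 be such that the capacitated flow polytope P^c_k of G^(k) (with netflow b_G^(k) = (indeg_G(1),...,indeg_G(n), −k, k−m) and capacities 0 ≤ f ≤ 1 on the y-edges) is nonempty, and define z_I^(k) = min { Σ_{i∈I} f(a_i) : f ∈ P^c_k } for I ⊆ [n]. Let P^c be the capacitated flow polytope of G^aug with netflow (indeg_G(1),...,indeg_G(n), −m) and capacities 0 ≤ f ≤ 1 on the y-edges, and let φ send a flow f to (f(a_1),...,f(a_n)). Then φ(P^c) ∩ { x ∈ ℝ^n : Σ_{i=1}^{n} x_i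 = m − k } = { x ∈ ℝ^n : Σ_{i∈I} x_i ≥ z_I^(k) for every proper subset I of [n], and Σ_{i=1}^{n} x_i = z_{[n]}^(k) }. (Equivalently, the intersection of the Newton polytope of the left-degree polynomial L_G with the hyperplane of coordinate sum m−k is the generalized permutahedron P_n^z{z_I^(k)}.) -/
noncomputable section

open Finset

/-- `z_I^(k) = min { ∑_{i∈I} f(a_i) : f ∈ P^c_k }`. -/
def zK (n : ℕ) (G : Finset (Fin (n + 1) × Fin (n + 1))) (k : ℕ)
    (I : Finset (Fin n)) : ℝ :=
  sInf ((fun f => ∑ i ∈ I, f (Sum.inl i)) '' capK n G k)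

/-- The divergence (outflow minus inflow) of `f` at the vertex `v`. -/
def flowDiv {V ι : Type*} [Fintype ι] [DecidableEq V] (src tgt : ι → V) (f : ι → ℝ) (v : V) : ℝ :=
  (∑ e, if src e = v then f e else 0) - (∑ e, if tgt e = v then f e else 0)

section FlowDiv

variable {V ι : Type*} [Fintype ι] [DecidableEq V] (src tgt : ι → V)

lemma flowDiv_add (f g : ι → ℝ) (v : V) :
    flowDiv src tgt (f + g) v = flowDiv src tgt f v + flowDiv src tgt g v := by
  have h (s : ι → V) : (∑ e, if s e = v then (f + g) e else 0) =
      (∑ e, if s e = v then f e else 0) + ∑ e, if s e = v then g e else 0 := by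
    rw [← Finset.sum_add_distrib]
    exact Finset.sum_congr rfl fun e _ => by split_ifs <;> simp
  simp only [flowDiv, h]
  ring

lemma flowDiv_smul (c : ℝ) (f : ι → ℝ) (v : V) :
    flowDiv src tgt (c • f) v = c * flowDiv src tgt f v := by
  simp only [flowDiv, mul_sub, Finset.mul_sum, mul_ite, mul_zero, Pi.smul_apply, smul_eq_mul]

lemma flowDiv_single [DecidableEq ι] (e : ι) (c : ℝ) (v : V) :
    flowDiv src tgt (Pi.single e c) v =
      (if v = src e then c else 0) - (if v = tgt e then c else 0) := by
  have h (s : ι → V) : (∑ e', if s e' = v then (Pi.single e c : ι → ℝ) e' else 0) =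
      if v = s e then c else 0 := by
    rw [Finset.sum_eq_single e]
    · simp [eq_comm]
    · intro b _ hb
      simp [hb]
    · simp
  rw [flowDiv, h, h]

/-- Summation by parts: pairing the divergence with a potential. -/
lemma sum_potential_mul_flowDiv [Fintype V] (p : V → ℝ) (f : ι → ℝ) :
    ∑ v, p v * flowDiv src tgt f v = ∑ e, f e * (p (src e) - p (tgt e)) := by
  have h (s : ι → V) : ∑ v, p v * (∑ e, if s e = v then f e else 0) = ∑ e, f e * p (s e) := by
    simp only [Finset.mul_sum]
    rw [Finset.sum_comm]
    exact Finset.sum_congr rfl fun e _ => by simp [mul_comm]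
  simp only [flowDiv, mul_sub, Finset.sum_sub_distrib, h]

lemma isClosed_flowPolytope (a : V → ℝ) : IsClosed (flowPolytope src tgt a) := by
  have h1 : IsClosed {f : ι → ℝ | ∀ e, 0 ≤ f e} := by
    simp only [Set.ofPred_forall]
    exact isClosed_iInter fun e => isClosed_le continuous_const (continuous_apply e)
  have h2 (s : ι → V) (v : V) : Continuous fun f : ι → ℝ => ∑ e, if s e = v then f e else 0 := by
    refine continuous_finsetSum _ fun e _ => ?_
    split_ifs <;> fun_prop
  have h3 : IsClosed {f : ι → ℝ | ∀ v, flowDiv src tgt f v = a v} := by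
    simp only [Set.ofPred_forall]
    exact isClosed_iInter fun v => isClosed_eq ((h2 src v).sub (h2 tgt v)) continuous_const
  exact h1.inter h3

/-- On an acyclic graph, as witnessed by a potential increasing along every edge, the flow polytope
is compact. -/
lemma isCompact_flowPolytope [Fintype V] (a p : V → ℝ) (hp : ∀ e, p (src e) + 1 ≤ p (tgt e)) :
    IsCompact (flowPolytope src tgt a) := by
  refine (isCompact_Icc (a := 0) (b := fun _ => -∑ v, p v * a v)).of_isClosed_subset
    (isClosed_flowPolytope src tgt a) fun f hf => ⟨hf.1, fun e => ?_⟩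
  have h : ∑ v, p v * a v = ∑ e, f e * (p (src e) - p (tgt e)) := by
    rw [← sum_potential_mul_flowDiv]
    exact Finset.sum_congr rfl fun v _ => congrArg _ (hf.2 v).symm
  calc f e ≤ ∑ e, f e := Finset.single_le_sum (fun e _ => hf.1 e) (Finset.mem_univ e)
    _ ≤ ∑ e, -(f e * (p (src e) - p (tgt e))) := by
        refine Finset.sum_le_sum fun e _ => ?_
        nlinarith [hf.1 e, hp e]
    _ = -∑ v, p v * a v := by rw [h, Finset.sum_neg_distrib]

end FlowDiv

section Terminals

variable {V A B : Type*} [DecidableEq V] [Fintype A] [Fintype B]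

/-- Flows with unit capacities on the internal edges satisfying `C`. -/
def cappedFlow (src tgt : A ⊕ B → V) (b : V → ℝ) (C : B → Prop) : Set (A ⊕ B → ℝ) :=
  {f | f ∈ flowPolytope src tgt b ∧ ∀ e, C e → f (Sum.inr e) ≤ 1}

/-- A direction `d`, supported on the internal edges, along which `f` can be moved a little
while staying nonnegative and below the capacities. -/
def IsResidual (C : B → Prop) (f d : A ⊕ B → ℝ) : Prop :=
  (∀ i, d (Sum.inl i) = 0) ∧ (∀ e, f (Sum.inr e) = 0 → 0 ≤ d (Sum.inr e)) ∧
    ∀ e, C e → f (Sum.inr e) = 1 → d (Sum.inr e) ≤ 0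

/-- The vertices from which residual flow can be sent to a terminal in `S`. -/
def residualReach (src tgt : A ⊕ B → V) (C : B → Prop) (f : A ⊕ B → ℝ) (S : Set A) : Set V :=
  {u | ∃ j ∈ S, ∃ d, IsResidual C f d ∧ ∀ v, flowDiv src tgt d v =
    (if v = u then 1 else 0) - (if v = src (Sum.inl j) then 1 else 0)}

lemma mem_residualReach_of_mem {src tgt : A ⊕ B → V} {C : B → Prop} {f : A ⊕ B → ℝ} {S : Set A}
    {j : A} (hj : j ∈ S) : src (Sum.inl j) ∈ residualReach src tgt C f S :=
  ⟨j, hj, 0, by simp [IsResidual], fun v => by simp [flowDiv]⟩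

variable [DecidableEq A] [DecidableEq B]

lemma src_mem_residualReach {src tgt : A ⊕ B → V} {C : B → Prop} {f : A ⊕ B → ℝ} {S : Set A}
    {e : B} (he : C e → f (Sum.inr e) ≠ 1)
    (h : tgt (Sum.inr e) ∈ residualReach src tgt C f S) :
    src (Sum.inr e) ∈ residualReach src tgt C f S := by
  obtain ⟨j, hj, d, ⟨h0, h1, h2⟩, hd⟩ := h
  refine ⟨j, hj, d + Pi.single (Sum.inr e) 1, ⟨fun i => by simp [h0], fun e' h => ?_,
    fun e' hC h => ?_⟩, fun v => ?_⟩
  · have := h1 e' h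
    have h' : (0 : A ⊕ B → ℝ) ≤ Pi.single (Sum.inr e) 1 := by simp
    have := h' (Sum.inr e')
    simp only [Pi.add_apply, Pi.zero_apply] at *
    linarith
  · have hne : (Sum.inr e' : A ⊕ B) ≠ Sum.inr e := by
      rintro heq
      obtain rfl := Sum.inr_injective heq
      exact he hC h
    simpa [Pi.single_eq_of_ne hne] using h2 e' hC h
  · rw [flowDiv_add, flowDiv_single, hd]
    ring

lemma tgt_mem_residualReach {src tgt : A ⊕ B → V} {C : B → Prop} {f : A ⊕ B → ℝ} {S : Set A}
    {e : B} (he : f (Sum.inr e) ≠ 0)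
    (h : src (Sum.inr e) ∈ residualReach src tgt C f S) :
    tgt (Sum.inr e) ∈ residualReach src tgt C f S := by
  obtain ⟨j, hj, d, ⟨h0, h1, h2⟩, hd⟩ := h
  refine ⟨j, hj, d + Pi.single (Sum.inr e) (-1), ⟨fun i => by simp [h0], fun e' h => ?_,
    fun e' hC h => ?_⟩, fun v => ?_⟩
  · have hne : (Sum.inr e' : A ⊕ B) ≠ Sum.inr e := by
      rintro heq
      obtain rfl := Sum.inr_injective heq
      exact he h
    simpa [Pi.single_eq_of_ne hne] using h1 e' h
  · have := h2 e' hC h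
    have h' : (Pi.single (Sum.inr e) (-1) : A ⊕ B → ℝ) ≤ 0 := by simp
    have := h' (Sum.inr e')
    simp only [Pi.add_apply, Pi.zero_apply] at *
    linarith
  · rw [flowDiv_add, flowDiv_single, hd]
    split_ifs <;> ring

/-- The terminals not in the residual reach of `S` carry the least possible total flow. -/
lemma sum_le_sum_of_residualReach [Fintype V] {src tgt : A ⊕ B → V} {b : V → ℝ} {C : B → Prop} {t : V}
    (hAt : ∀ i, tgt (Sum.inl i) = t) (hAs : ∀ i, src (Sum.inl i) ≠ t)
    (hBs : ∀ e, src (Sum.inr e) ≠ t) (hBt : ∀ e, tgt (Sum.inr e) ≠ t)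
    {f g : A ⊕ B → ℝ} (hf : f ∈ cappedFlow src tgt b C) (hg : g ∈ cappedFlow src tgt b C)
    (S : Set A) {I : Finset A}
    (hI : ∀ i, i ∈ I ↔ src (Sum.inl i) ∉ residualReach src tgt C f S) :
    ∑ i ∈ I, f (Sum.inl i) ≤ ∑ i ∈ I, g (Sum.inl i) := by
  classical
  set R := residualReach src tgt C f S
  let p : V → ℝ := fun v => if v = t then 0 else if v ∈ R then 0 else 1
  have key : ∑ e, f e * (p (src e) - p (tgt e)) = ∑ e, g e * (p (src e) - p (tgt e)) := by
    rw [← sum_potential_mul_flowDiv, ← sum_potential_mul_flowDiv]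
    exact Finset.sum_congr rfl fun v _ => by
      rw [show flowDiv src tgt f v = b v from hf.1.2 v, show flowDiv src tgt g v = b v from hg.1.2 v]
  have hA (h : A ⊕ B → ℝ) :
      ∑ i, h (Sum.inl i) * (p (src (Sum.inl i)) - p (tgt (Sum.inl i))) =
        ∑ i ∈ I, h (Sum.inl i) := by
    rw [← Finset.sum_subset (Finset.subset_univ I)]
    · refine Finset.sum_congr rfl fun i hi => ?_
      simp [p, hAt, hAs, (hI i).1 hi]
    · intro i _ hi
      have : src (Sum.inl i) ∈ R := by
        by_contra h
        exact hi ((hI i).2 h)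
      simp [p, hAt, this]
  have hB : ∑ e, g (Sum.inr e) * (p (src (Sum.inr e)) - p (tgt (Sum.inr e))) ≤
      ∑ e, f (Sum.inr e) * (p (src (Sum.inr e)) - p (tgt (Sum.inr e))) := by
    refine Finset.sum_le_sum fun e _ => ?_
    simp only [p, hBs, hBt, if_false]
    by_cases hs : src (Sum.inr e) ∈ R <;> by_cases ht : tgt (Sum.inr e) ∈ R
    · simp [hs, ht]
    · have h0 : f (Sum.inr e) = 0 := by
        by_contra h
        exact ht (tgt_mem_residualReach h hs)
      have := hg.1.1 (Sum.inr e)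
      simp [hs, ht, h0, this]
    · have h1 : C e ∧ f (Sum.inr e) = 1 := by
        by_contra h
        exact hs (src_mem_residualReach (fun hC h' => h ⟨hC, h'⟩) ht)
      have := hg.2 e h1.1
      simp [hs, ht, h1.2, this]
    · simp [hs, ht]
  rw [Fintype.sum_sum_type, Fintype.sum_sum_type, hA, hA] at key
  linarith

/-- If residual flow can be sent from terminal `i`, where `f` exceeds `x`, to a terminal where `f`
is below `x`, then `f` can be moved closer to `x`. -/
lemma exists_closer_of_mem_residualReach {src tgt : A ⊕ B → V} {b : V → ℝ} {C : B → Prop} {t : V}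
    (hAt : ∀ i, tgt (Sum.inl i) = t) {f : A ⊕ B → ℝ} (hf : f ∈ cappedFlow src tgt b C)
    {x : A → ℝ} {i : A} (hi : x i < f (Sum.inl i)) (hi0 : 0 < f (Sum.inl i))
    (hR : src (Sum.inl i) ∈ residualReach src tgt C f {j | f (Sum.inl j) < x j}) :
    ∃ g ∈ cappedFlow src tgt b C,
      ∑ l, |x l - g (Sum.inl l)| < ∑ l, |x l - f (Sum.inl l)| := by
  obtain ⟨j, hj, d, ⟨h0, h1, h2⟩, hd⟩ := hR
  simp only [Set.mem_ofPred_eq] at hj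
  have hij : i ≠ j := by
    rintro rfl
    linarith
  set D : A ⊕ B → ℝ := d + Pi.single (Sum.inl i) (-1) + Pi.single (Sum.inl j) 1 with hD
  have hDdiv (v : V) : flowDiv src tgt D v = 0 := by
    rw [hD, flowDiv_add, flowDiv_add, flowDiv_single, flowDiv_single, hd, hAt, hAt]
    split_ifs <;> ring
  have hDi : D (Sum.inl i) = -1 := by simp [hD, h0, hij]
  have hDj : D (Sum.inl j) = 1 := by simp [hD, h0, hij.symm]
  have hDl (l : A) (h : l ≠ i) (h' : l ≠ j) : D (Sum.inl l) = 0 := by simp [hD, h0, h, h']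
  have hDe (e : B) : D (Sum.inr e) = d (Sum.inr e) := by simp [hD]
  have hD0 (e : A ⊕ B) (he : f e = 0) : 0 ≤ D e := by
    rcases e with l | e
    · by_cases hl : l = i
      · subst hl
        linarith
      · by_cases hl' : l = j
        · subst hl'
          simp [hDj]
        · simp [hDl l hl hl']
    · rw [hDe]
      exact h1 e he
  have hlim (e : A ⊕ B) : Filter.Tendsto (fun ε : ℝ => f e + ε * D e)
      (nhdsWithin 0 (Set.Ioi 0)) (nhds (f e)) := by
    have : Continuous fun ε : ℝ => f e + ε * D e := by fun_prop
    simpa using (this.tendsto 0).mono_left nhdsWithin_le_nhds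
  have hpos : ∀ᶠ ε : ℝ in nhdsWithin 0 (Set.Ioi 0), 0 < ε := self_mem_nhdsWithin
  have hnn : ∀ᶠ ε : ℝ in nhdsWithin 0 (Set.Ioi 0), ∀ e, 0 ≤ f e + ε * D e := by
    refine Filter.eventually_all.2 fun e => ?_
    rcases (hf.1.1 e).eq_or_lt with he | he
    · filter_upwards [hpos] with ε hε
      have := mul_nonneg hε.le (hD0 e he.symm)
      linarith
    · exact ((hlim e).eventually_const_lt he).mono fun _ h => h.le
  have hcap : ∀ᶠ ε : ℝ in nhdsWithin 0 (Set.Ioi 0),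
      ∀ e, C e → f (Sum.inr e) + ε * D (Sum.inr e) ≤ 1 := by
    refine Filter.eventually_all.2 fun e => ?_
    by_cases hC : C e
    · rcases (hf.2 e hC).eq_or_lt with he | he
      · filter_upwards [hpos] with ε hε _
        have := mul_nonpos_of_nonneg_of_nonpos hε.le (h2 e hC he)
        rw [hDe]
        linarith
      · exact ((hlim (Sum.inr e)).eventually_lt_const he).mono fun _ h _ => h.le
    · exact Filter.Eventually.of_forall fun _ h => absurd h hC
  obtain ⟨ε, hε, hnn, hcap, hεi, hεj⟩ := (hpos.and (hnn.and (hcap.and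
    (((hlim (Sum.inl i)).eventually_const_lt hi).and
      ((hlim (Sum.inl j)).eventually_lt_const hj))))).exists
  refine ⟨f + ε • D, ⟨⟨hnn, fun v => ?_⟩, hcap⟩, ?_⟩
  · change flowDiv src tgt (f + ε • D) v = b v
    rw [flowDiv_add, flowDiv_smul, hDdiv, mul_zero, add_zero]
    exact hf.1.2 v
  · simp only [Pi.add_apply, Pi.smul_apply, smul_eq_mul]
    have hlt_i : |x i - (f (Sum.inl i) + ε * D (Sum.inl i))| < |x i - f (Sum.inl i)| := by
      rw [hDi] at *
      rw [abs_of_neg (by linarith), abs_of_neg (by linarith)]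
      linarith
    refine Finset.sum_lt_sum (fun l _ => ?_) ⟨i, Finset.mem_univ i, hlt_i⟩
    by_cases hl : l = i
    · exact hl ▸ hlt_i.le
    · by_cases hl' : l = j
      · subst hl'
        rw [hDj] at *
        rw [abs_of_pos (by linarith), abs_of_pos (by linarith)]
        linarith
      · simp [hDl l hl hl']

/-- The projection of a compact capacitated flow polytope to its terminal edges contains every
point satisfying the subset-sum inequalities. -/
lemma exists_cappedFlow_of_sInf_le [Fintype V] {src tgt : A ⊕ B → V} {b : V → ℝ} {C : B → Prop} {t : V}
    (hAt : ∀ i, tgt (Sum.inl i) = t) (hAs : ∀ i, src (Sum.inl i) ≠ t)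
    (hBs : ∀ e, src (Sum.inr e) ≠ t) (hBt : ∀ e, tgt (Sum.inr e) ≠ t)
    (hcpt : IsCompact (cappedFlow src tgt b C)) (hne : (cappedFlow src tgt b C).Nonempty)
    {x : A → ℝ}
    (hI : ∀ I : Finset A, I ≠ Finset.univ →
      sInf ((fun f => ∑ i ∈ I, f (Sum.inl i)) '' cappedFlow src tgt b C) ≤ ∑ i ∈ I, x i)
    (hsum : ∀ f ∈ cappedFlow src tgt b C, ∑ i, f (Sum.inl i) = ∑ i, x i) :
    ∃ f ∈ cappedFlow src tgt b C, ∀ i, f (Sum.inl i) = x i := by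
  classical
  obtain ⟨f, hf, hmin⟩ := hcpt.exists_isMinOn hne
    (f := fun f => ∑ l, |x l - f (Sum.inl l)|) (by fun_prop)
  refine ⟨f, hf, ?_⟩
  by_cases hS : ∃ j, f (Sum.inl j) < x j
  · obtain ⟨j, hj⟩ := hS
    exfalso
    let S : Set A := {j | f (Sum.inl j) < x j}
    let I : Finset A :=
      Finset.univ.filter fun i => src (Sum.inl i) ∉ residualReach src tgt C f S
    have hmem (i : A) : i ∈ I ↔ src (Sum.inl i) ∉ residualReach src tgt C f S := by simp [I]
    have hjI : j ∉ I := fun h => (hmem j).1 h (mem_residualReach_of_mem hj)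
    have hIx : ∑ i ∈ I, f (Sum.inl i) ≤ ∑ i ∈ I, x i := by
      refine le_trans (le_csInf (hne.image _) ?_) (hI I fun h => hjI (h ▸ Finset.mem_univ j))
      rintro _ ⟨g, hg, rfl⟩
      exact sum_le_sum_of_residualReach hAt hAs hBs hBt hf hg S hmem
    have hout (i : A) (hi : i ∉ I) : f (Sum.inl i) ≤ x i := by
      by_contra! hlt
      have hij : i ≠ j := by
        rintro rfl
        linarith
      have hx0 : 0 ≤ x i := by
        have := hI {i} fun h => hij (Finset.mem_singleton.1 (h ▸ Finset.mem_univ j)).symm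
        rw [Finset.sum_singleton] at this
        refine le_trans (Real.sInf_nonneg ?_) this
        rintro _ ⟨g, hg, rfl⟩
        simpa using hg.1.1 (Sum.inl i)
      have hiR : src (Sum.inl i) ∈ residualReach src tgt C f S := by
        by_contra h
        exact hi ((hmem i).2 h)
      obtain ⟨g, hg, hlt'⟩ :=
        exists_closer_of_mem_residualReach hAt hf hlt (hx0.trans_lt hlt) hiR
      exact (isMinOn_iff.1 hmin g hg).not_gt hlt'
    have hlt : ∑ i ∈ Iᶜ, f (Sum.inl i) < ∑ i ∈ Iᶜ, x i :=
      Finset.sum_lt_sum (fun i hi => hout i (Finset.mem_compl.1 hi))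
        ⟨j, Finset.mem_compl.2 hjI, hj⟩
    have := hsum f hf
    rw [← Finset.sum_add_sum_compl I, ← Finset.sum_add_sum_compl I] at this
    linarith
  · push Not at hS
    have := (Finset.sum_eq_sum_iff_of_le fun i _ => hS i).1 (hsum f hf).symm
    exact fun i => (this i (Finset.mem_univ i)).symm

end Terminals

section HyperplaneSection

variable (n : ℕ) (G : Finset (Fin (n + 1) × Fin (n + 1))) (k : ℕ)

lemma capK_eq_cappedFlow :
    capK n G k = cappedFlow (srcK n G) (tgtK n G) (bK n G k) fun e => e.isRight = true := by
  ext f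
  simp [capK, cappedFlow]

lemma flowDiv_K_castSucc (f : Fin n ⊕ ↥(EG0 n G) ⊕ ↥(EG0 n G) → ℝ) (v : Fin (n + 1)) :
    flowDiv (srcK n G) (tgtK n G) f (some v.castSucc) =
      flowDiv (srcAug n G) (tgtAug n G) f (some v) := by
  simp [flowDiv, srcK, tgtK, srcAug, tgtAug, (Fin.castSucc_ne_last v).symm, Fin.ext_iff]

lemma flowDiv_K_last (f : Fin n ⊕ ↥(EG0 n G) ⊕ ↥(EG0 n G) → ℝ) :
    flowDiv (srcK n G) (tgtK n G) f (some (Fin.last (n + 1))) =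
      -∑ e, f (Sum.inr (Sum.inr e)) := by
  simp [flowDiv, srcK, tgtK, Fin.castSucc_ne_last]

lemma flowDiv_K_none (f : Fin n ⊕ ↥(EG0 n G) ⊕ ↥(EG0 n G) → ℝ) :
    flowDiv (srcK n G) (tgtK n G) f none = -∑ i, f (Sum.inl i) := by
  simp [flowDiv, srcK, tgtK]

lemma flowDiv_aug_none (f : Fin n ⊕ ↥(EG0 n G) ⊕ ↥(EG0 n G) → ℝ) :
    flowDiv (srcAug n G) (tgtAug n G) f none =
      -(∑ i, f (Sum.inl i) + ∑ e, f (Sum.inr (Sum.inr e))) := by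
  simp [flowDiv, srcAug, tgtAug]

lemma bK_castSucc (v : Fin (n + 1)) : bK n G k (some v.castSucc) = bGF n G ∅ (some v) := by
  have h1 : ((v.castSucc : Fin (n + 2)) : ℕ) ≠ n + 1 := v.isLt.ne
  have h2 : ((v.castSucc : Fin (n + 2)) : ℕ) = 0 ↔ v = 0 := by simp
  simp only [bK, bGF, if_neg h1, h2]
  simp [indeg, outdeg, Fin.val_inj]

/-- The flows in `P^c_k` are the flows in `P^c` with total flow `m - k` on the `a`-edges. -/
lemma mem_capK_iff (f : Fin n ⊕ ↥(EG0 n G) ⊕ ↥(EG0 n G) → ℝ) :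
    f ∈ capK n G k ↔ f ∈ capAug n G ∧ ∑ i, f (Sum.inl i) = (G.card : ℝ) - k := by
  have hlast : bK n G k (some (Fin.last (n + 1))) = -(k : ℝ) := by simp [bK]
  have hnone : bK n G k none = (k : ℝ) - G.card := rfl
  have hnone' : bGF n G ∅ none = -(G.card : ℝ) := by simp [bGF]
  have hK : (∀ v, flowDiv (srcK n G) (tgtK n G) f v = bK n G k v) ↔
      (∀ v, flowDiv (srcAug n G) (tgtAug n G) f v = bGF n G ∅ v) ∧
        ∑ i, f (Sum.inl i) = (G.card : ℝ) - k := by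
    rw [Option.forall, Option.forall, Fin.forall_fin_succ']
    simp only [flowDiv_K_castSucc, flowDiv_K_last, flowDiv_K_none, flowDiv_aug_none, bK_castSucc,
      hlast, hnone, hnone']
    constructor
    · rintro ⟨h1, h2, h3⟩
      exact ⟨⟨by linarith, h2⟩, by linarith⟩
    · rintro ⟨⟨h1, h2⟩, h3⟩
      exact ⟨by linarith, h2, by linarith⟩
  constructor
  · rintro ⟨⟨h0, h1⟩, h2⟩
    exact ⟨⟨⟨h0, (hK.1 h1).1⟩, h2⟩, (hK.1 h1).2⟩
  · rintro ⟨⟨⟨h0, h1⟩, h2⟩, h3⟩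
    exact ⟨⟨h0, hK.2 ⟨h1, h3⟩⟩, h2⟩

lemma isCompact_capK (hG : ∀ e ∈ G, e.1 < e.2) : IsCompact (capK n G k) := by
  have hflow : IsCompact (flowPolytope (srcK n G) (tgtK n G) (bK n G k)) := by
    refine isCompact_flowPolytope _ _ _
      (fun o => o.elim (n + 1 : ℝ) fun v => ((v : ℕ) : ℝ)) fun e => ?_
    rcases e with j | e | e
    · have := j.isLt
      simp only [srcK, tgtK, Option.elim, Fin.val_castSucc, Fin.val_succ]
      exact_mod_cast (by omega : (j : ℕ) + 1 + 1 ≤ n + 1)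
    · have := hG e.1 (Finset.mem_filter.1 e.2).1
      simp only [srcK, tgtK, Option.elim, Fin.val_castSucc]
      exact_mod_cast (by omega : (e.1.1 : ℕ) + 1 ≤ e.1.2)
    · have := e.1.1.isLt
      simp only [srcK, tgtK, Option.elim, Fin.val_castSucc, Fin.val_last]
      exact_mod_cast (by omega : (e.1.1 : ℕ) + 1 ≤ n + 1)
  refine hflow.inter_right (t := {f | ∀ e : ↥(EG0 n G), f (Sum.inr (Sum.inr e)) ≤ 1}) ?_
  simp only [Set.ofPred_forall]
  exact isClosed_iInter fun e => isClosed_le (continuous_apply _) continuous_const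

lemma zK_univ (hne : (capK n G k).Nonempty) :
    zK n G k Finset.univ = (G.card : ℝ) - k := by
  have h : (fun f => ∑ i, f (Sum.inl i)) '' capK n G k = {(G.card : ℝ) - k} := by
    rw [← hne.image_const]
    exact Set.image_congr fun f hf => ((mem_capK_iff n G k f).1 hf).2
  rw [zK, h, csInf_singleton]

lemma zK_le {f : Fin n ⊕ ↥(EG0 n G) ⊕ ↥(EG0 n G) → ℝ} (hf : f ∈ capK n G k)
    (I : Finset (Fin n)) : zK n G k I ≤ ∑ i ∈ I, f (Sum.inl i) := by
  refine csInf_le ⟨0, ?_⟩ ⟨f, hf, rfl⟩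
  rintro _ ⟨g, hg, rfl⟩
  exact Finset.sum_nonneg fun i _ => hg.1.1 _

end HyperplaneSection

/-- Corollary: hyperplane sections of the Newton polytope of the
left-degree polynomial.  For a simple graph `G` on `[0,n]` with `m = #E(G)` edges and
`k ≥ 0` with `P^c_k` nonempty, the intersection of `φ(P^c)` (the Newton polytope of the
left-degree polynomial `L_G`) with the hyperplane `∑ x_i = m − k` equals the generalized
permutahedron `P_n^z{z_I^(k)}`. -/
theorem newton_hyperplane_section (n : ℕ) (G : Finset (Fin (n + 1) × Fin (n + 1)))
    (hG : ∀ e ∈ G, e.1 < e.2) (k : ℕ) (hne : (capK n G k).Nonempty) :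
    ((fun f : (Fin n ⊕ ↥(EG0 n G) ⊕ ↥(EG0 n G)) → ℝ => fun i : Fin n => f (Sum.inl i)) ''
        capAug n G) ∩ {x : Fin n → ℝ | ∑ i, x i = (G.card : ℝ) - (k : ℝ)} =
      {x : Fin n → ℝ |
        (∀ I : Finset (Fin n), I ≠ Finset.univ → zK n G k I ≤ ∑ i ∈ I, x i) ∧
        ∑ i, x i = zK n G k Finset.univ} := by
  ext x
  constructor
  · rintro ⟨⟨f, hf, rfl⟩, hsum⟩
    have hfK := (mem_capK_iff n G k f).2 ⟨hf, hsum⟩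
    exact ⟨fun I _ => zK_le n G k hfK I, hsum.trans (zK_univ n G k hne).symm⟩
  · rintro ⟨hI, hsum⟩
    rw [zK_univ n G k hne] at hsum
    have hcpt := isCompact_capK n G k hG
    simp only [zK] at hI
    rw [capK_eq_cappedFlow] at hcpt hne hI
    obtain ⟨f, hf, hfx⟩ := exists_cappedFlow_of_sInf_le (t := none) (fun _ => rfl)
      (fun _ => by simp [srcK]) (fun e => by rcases e with e | e <;> simp [srcK])
      (fun e => by rcases e with e | e <;> simp [tgtK]) hcpt hne hI fun f hf => by
        rw [← capK_eq_cappedFlow, mem_capK_iff] at hf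
        rw [hf.2, hsum]
    rw [← capK_eq_cappedFlow, mem_capK_iff] at hf
    exact ⟨⟨f, hf.1, funext hfx⟩, hsum⟩
end
end

section
/- Let π ∈ S_{n+1} be of the form π = 1π', where π' is a dominant permutation of {2,...,n+1}. Then the Schubert polynomial 𝔖_π ∈ ℤ[x_1,...,x_n] equals the integer-point transform of its Newton polytope: every coefficient of 𝔖_π is 0 or 1, and a lattice point α lies in Newton(𝔖_π) if and only if the monomial x^α appears in 𝔖_π with coefficient 1. Moreover, Newton(𝔖_π) is a generalized permutahedron. -/
noncomputable section

open MvPolynomial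

/-- `S` is the family of Schubert polynomials of `S_{n+1}` (permutations of
`{1,…,n+1}`, 0-indexed as `Equiv.Perm (Fin (n+1))`; the variable `X i` stands for
`x_{i+1}`): `S w₀ = x_1^n x_2^{n-1} ⋯ x_n` for the longest element `w₀`, and
`S w = ∂_i S_{w sᵢ}` whenever `w(i) < w(i+1)`, the latter written in the equivalent
denominator-free form `(x_i − x_{i+1}) · S w = S_{w sᵢ} − sᵢ · S_{w sᵢ}`. -/
def IsSchubertFamily (n : ℕ)
    (S : Equiv.Perm (Fin (n + 1)) → MvPolynomial (Fin (n + 1)) ℤ) : Prop :=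
  S Fin.revPerm = ∏ i : Fin (n + 1), X i ^ (n - (i : ℕ)) ∧
  ∀ (w : Equiv.Perm (Fin (n + 1))) (i : Fin n), w i.castSucc < w i.succ →
    (X i.castSucc - X i.succ) * S w =
      S (w * Equiv.swap i.castSucc i.succ) -
        rename (Equiv.swap i.castSucc i.succ) (S (w * Equiv.swap i.castSucc i.succ))

/-- The Newton polytope of a polynomial: the convex hull of its exponent vectors. -/
def newtonPolytope {N : ℕ} (f : MvPolynomial (Fin N) ℤ) : Set (Fin N → ℝ) :=
  convexHull ℝ {v | ∃ d ∈ f.support, v = fun i => ((d i : ℕ) : ℝ)}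

/-- A generalized permutahedron: a set of the form
`{ x : ∑_{i∈I} x_i ≥ z_I for proper I, ∑ x_i = z_{[N]} }` for a supermodular family
`z` with `z_∅ = 0`. -/
def IsGenPermutahedron {N : ℕ} (P : Set (Fin N → ℝ)) : Prop :=
  ∃ z : Finset (Fin N) → ℝ, z ∅ = 0 ∧
    (∀ I J : Finset (Fin N), z I + z J ≤ z (I ∪ J) + z (I ∩ J)) ∧
    P = {x | (∀ I : Finset (Fin N), I ≠ Finset.univ → z I ≤ ∑ i ∈ I, x i) ∧
      ∑ i, x i = z Finset.univ}

/-- The sum of the entries of `f` in positions at least `t`. -/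
def tailSum {N : ℕ} {R : Type*} [AddCommMonoid R] (f : Fin N → R) (t : ℕ) : R :=
  ∑ i with t ≤ Fin.val i, f i

theorem tailSum_eq_add {N : ℕ} {R : Type*} [AddCommMonoid R] (f : Fin N → R) (i : Fin N) :
    tailSum f i = f i + tailSum f (i + 1) := by
  have h : (Finset.univ.filter fun j : Fin N => (i : ℕ) ≤ j) =
      insert i (Finset.univ.filter fun j : Fin N => (i : ℕ) + 1 ≤ j) := by
    ext j
    simp [Fin.ext_iff]
    omega
  rw [tailSum, h, Finset.sum_insert (by simp), tailSum]

theorem tailSum_congr {N : ℕ} {R : Type*} [AddCommMonoid R] {f g : Fin N → R} {t : ℕ}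
    (h : ∀ i : Fin N, t ≤ i → f i = g i) : tailSum f t = tailSum g t :=
  Finset.sum_congr rfl fun i hi => h i (by simpa using hi)

theorem tailSum_zero {N : ℕ} {R : Type*} [AddCommMonoid R] (f : Fin N → R) :
    tailSum f 0 = ∑ i, f i := by
  simp [tailSum]

theorem tailSum_of_le {N : ℕ} {R : Type*} [AddCommMonoid R] (f : Fin N → R) {t : ℕ}
    (h : N ≤ t) : tailSum f t = 0 :=
  Finset.sum_eq_zero fun i hi => by
    have := i.isLt
    simp at hi
    omega

/-- The exponent vectors of the Schubert polynomial of the permutation obtained from a dominant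
permutation with code `b` by inserting a new smallest value in position `p`. -/
structure IsInsertionExponent {N : ℕ} (b : ℕ → ℕ) (p : ℕ) (d : Fin N → ℕ) : Prop where
  eq_of_lt : ∀ i : Fin N, (i : ℕ) < p → d i = b i + 1
  le_of_gt : ∀ i : Fin N, p < i → d i ≤ b (i - 1)
  tail_le : ∀ t, p < t → tailSum (fun i : Fin N => b i) t ≤ tailSum d t
  tail_eq : tailSum (fun i : Fin N => b i) p = tailSum d p

/-- The conditions shared by the exponent vectors for the insertion positions `p` and `p + 1`. -/
structure IsCommonExponent {N : ℕ} (b : ℕ → ℕ) (p : ℕ) (d : Fin N → ℕ) : Prop where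
  eq_of_lt : ∀ i : Fin N, (i : ℕ) < p → d i = b i + 1
  le_of_gt : ∀ i : Fin N, p + 1 < i → d i ≤ b (i - 1)
  tail_le : ∀ t, p + 1 < t → tailSum (fun i : Fin N => b i) t ≤ tailSum d t

theorem IsCommonExponent.congr {N : ℕ} {b : ℕ → ℕ} {p : ℕ} {d e : Fin N → ℕ}
    (h : IsCommonExponent b p d) (hde : ∀ i : Fin N, (i : ℕ) ≠ p → (i : ℕ) ≠ p + 1 → d i = e i) :
    IsCommonExponent b p e where
  eq_of_lt i hi := by rw [← hde i (by omega) (by omega), h.eq_of_lt i hi]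
  le_of_gt i hi := by rw [← hde i (by omega) (by omega)]; exact h.le_of_gt i hi
  tail_le t ht := by
    rw [← tailSum_congr (f := d) fun i hi => hde i (by omega) (by omega)]
    exact h.tail_le t ht

theorem isInsertionExponent_iff {n : ℕ} (b : ℕ → ℕ) (p : Fin n) (d : Fin (n + 1) → ℕ) :
    IsInsertionExponent b p d ↔ IsCommonExponent b p d ∧ d p.succ ≤ b p ∧
      b (p + 1) + tailSum (fun i : Fin (n + 1) => b i) (p + 2) ≤
        d p.succ + tailSum d (p + 2) ∧
      b p + b (p + 1) + tailSum (fun i : Fin (n + 1) => b i) (p + 2) =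
        d p.castSucc + d p.succ + tailSum d (p + 2) := by
  have h1 := tailSum_eq_add d p.castSucc
  have h2 := tailSum_eq_add d p.succ
  have h3 := tailSum_eq_add (fun i : Fin (n + 1) => b i) p.castSucc
  have h4 := tailSum_eq_add (fun i : Fin (n + 1) => b i) p.succ
  simp only [Fin.val_succ, Fin.val_castSucc, add_assoc, Nat.reduceAdd] at h1 h2 h3 h4
  constructor
  · rintro ⟨ha, hb, hc, hd⟩
    refine ⟨⟨ha, fun i hi => hb i (by omega), fun t ht => hc t (by omega)⟩, ?_, ?_, ?_⟩
    · simpa using hb p.succ (by simp)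
    · have := hc (p + 1) (by omega)
      omega
    · omega
  · rintro ⟨⟨ha, hb, hc⟩, h5, h6, h7⟩
    refine ⟨ha, fun i hi => ?_, fun t ht => ?_, by omega⟩
    · by_cases hi' : (i : ℕ) = p + 1
      · obtain rfl : i = p.succ := Fin.ext (by simpa using hi')
        simpa using h5
      · exact hb i (by omega)
    · by_cases ht' : t = p + 1
      · subst ht'
        omega
      · exact hc t (by omega)

theorem isInsertionExponent_succ_iff {n : ℕ} (b : ℕ → ℕ) (p : Fin n) (d : Fin (n + 1) → ℕ) :
    IsInsertionExponent b (p + 1) d ↔ IsCommonExponent b p d ∧ d p.castSucc = b p + 1 ∧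
      b (p + 1) + tailSum (fun i : Fin (n + 1) => b i) (p + 2) =
        d p.succ + tailSum d (p + 2) := by
  have h2 := tailSum_eq_add d p.succ
  have h4 := tailSum_eq_add (fun i : Fin (n + 1) => b i) p.succ
  simp only [Fin.val_succ, add_assoc, Nat.reduceAdd] at h2 h4
  constructor
  · rintro ⟨ha, hb, hc, hd⟩
    refine ⟨⟨fun i hi => ha i (by omega), hb, hc⟩, ?_, by omega⟩
    simpa using ha p.castSucc (by simp)
  · rintro ⟨⟨ha, hb, hc⟩, h5, h6⟩
    refine ⟨fun i hi => ?_, hb, hc, by omega⟩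
    by_cases hi' : (i : ℕ) = p
    · obtain rfl : i = p.castSucc := Fin.ext (by simpa using hi')
      simpa using h5
    · exact ha i (by omega)

theorem tailSum_pred {n : ℕ} {b : ℕ → ℕ} (hbn : b n = 0) (t : ℕ) :
    tailSum (fun i : Fin (n + 1) => b (i - 1)) (t + 1) = tailSum (fun i : Fin (n + 1) => b i) t := by
  obtain ht | ht := Nat.lt_or_ge n t
  · rw [tailSum_of_le _ (by omega), tailSum_of_le _ (by omega)]
  induction ht using Nat.decreasingInduction with
  | self =>
    rw [tailSum_of_le _ le_rfl]
    have := tailSum_eq_add (fun i : Fin (n + 1) => b i) (Fin.last n)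
    rw [Fin.val_last, tailSum_of_le _ le_rfl, hbn] at this
    exact this.symm
  | of_succ k hk ih =>
    have h1 := tailSum_eq_add (fun i : Fin (n + 1) => b (i - 1)) ⟨k + 1, by omega⟩
    have h2 := tailSum_eq_add (fun i : Fin (n + 1) => b i) ⟨k, by omega⟩
    simp only [Nat.add_sub_cancel] at h1 h2
    rw [h1, h2, ih]

theorem IsCommonExponent.tailSum_le {n : ℕ} {b : ℕ → ℕ} (hbn : b n = 0) {p : Fin n}
    {d : Fin (n + 1) → ℕ} (h : IsCommonExponent b p d) :
    tailSum d (p + 2) ≤ b (p + 1) + tailSum (fun i : Fin (n + 1) => b i) (p + 2) := by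
  have h1 := tailSum_eq_add (fun i : Fin (n + 1) => b i) p.succ
  simp only [Fin.val_succ, add_assoc, Nat.reduceAdd] at h1
  rw [← h1, ← tailSum_pred hbn]
  refine Finset.sum_le_sum fun i hi => h.le_of_gt i ?_
  simp at hi
  omega

theorem IsInsertionExponent.apply_le {N : ℕ} {b : ℕ → ℕ} {p : ℕ} {d : Fin N → ℕ}
    (hb : Antitone b) (h : IsInsertionExponent b p d) (i : Fin N) : d i ≤ b 0 + 1 := by
  rcases lt_trichotomy (i : ℕ) p with hi | hi | hi
  · have := hb (Nat.zero_le i)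
    have := h.eq_of_lt i hi
    omega
  · have h1 := h.tail_le (i + 1) (by omega)
    have h2 := h.tail_eq
    have h3 := tailSum_eq_add d i
    have h4 := tailSum_eq_add (fun i : Fin N => b i) i
    have := hb (Nat.zero_le i)
    rw [← hi] at h2
    omega
  · have := hb (Nat.zero_le (i - 1))
    have := h.le_of_gt i hi
    omega

open Classical in
/-- If the coefficients of `f` are `0` and `1`, with support described by the insertion exponents
for position `p + 1`, then its divided difference is described by position `p`. -/
theorem coeff_of_dividedDifference {n : ℕ} {b : ℕ → ℕ} (hb : Antitone b) (hbn : b n = 0)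
    (p : Fin n) {f g : MvPolynomial (Fin (n + 1)) ℤ}
    (hf : ∀ d, coeff d f = if IsInsertionExponent b (p + 1) d then 1 else 0)
    (hg : (X p.castSucc - X p.succ) * g = f - rename (Equiv.swap p.castSucc p.succ) f)
    (d : Fin (n + 1) →₀ ℕ) :
    coeff d g = if IsInsertionExponent b p d then 1 else 0 := by
  have hfin : {d : Fin (n + 1) →₀ ℕ | IsInsertionExponent b p d}.Finite := by
    refine (Set.finite_Iic (Finsupp.equivFunOnFinite.symm fun _ => b 0 + 1)).subset ?_
    intro d hd i
    simpa using IsInsertionExponent.apply_le hb hd i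
  set g' : MvPolynomial (Fin (n + 1)) ℤ := ∑ d ∈ hfin.toFinset, monomial d 1 with hg'
  have hcoeff : ∀ d, coeff d g' = if IsInsertionExponent b p d then 1 else 0 := by
    intro d
    simp [hg', coeff_sum, coeff_monomial]
  suffices h : (X p.castSucc - X p.succ) * g' =
      f - rename (Equiv.swap p.castSucc p.succ) f by
    have hne : (X p.castSucc - X p.succ : MvPolynomial (Fin (n + 1)) ℤ) ≠ 0 := by
      rw [sub_ne_zero]
      intro hX
      exact absurd (X_injective hX) (Fin.castSucc_lt_succ).ne
    rw [mul_left_cancel₀ hne (hg.trans h.symm), hcoeff]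
  ext m
  have hswap : coeff m (rename (Equiv.swap p.castSucc p.succ) f) =
      coeff (m.equivMapDomain (Equiv.swap p.castSucc p.succ)) f := by
    rw [← coeff_rename_mapDomain _ (Equiv.swap p.castSucc p.succ).injective f,
      ← Finsupp.equivMapDomain_eq_mapDomain]
    congr 1
    ext i
    simp [Finsupp.equivMapDomain_apply]
  have hpq : p.castSucc ≠ p.succ := (Fin.castSucc_lt_succ).ne
  rw [sub_mul, coeff_sub, coeff_sub, hswap, coeff_X_mul', coeff_X_mul', hcoeff, hcoeff, hf, hf]
  simp only [isInsertionExponent_iff, isInsertionExponent_succ_iff]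
  have hoff : ∀ (e : Fin (n + 1) →₀ ℕ), (∀ i, i ≠ p.castSucc → i ≠ p.succ → m i = e i) →
      (IsCommonExponent b p e ↔ IsCommonExponent b p m) ∧
        tailSum e (p + 2) = tailSum m (p + 2) := by
    intro e he
    have he' : ∀ i : Fin (n + 1), (i : ℕ) ≠ p → (i : ℕ) ≠ p + 1 → m i = e i := fun i h1 h2 =>
      he i (fun h => h1 (by simp [h])) (fun h => h2 (by simp [h]))
    refine ⟨⟨fun h => h.congr fun i h1 h2 => (he' i h1 h2).symm, fun h => h.congr he'⟩, ?_⟩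
    exact tailSum_congr fun i hi => (he' i (by omega) (by omega)).symm
  obtain ⟨r1, t1⟩ := hoff (m - Finsupp.single p.castSucc 1) (by
    intro i h1 h2
    simp [Ne.symm h1])
  obtain ⟨r2, t2⟩ := hoff (m - Finsupp.single p.succ 1) (by
    intro i h1 h2
    simp [Ne.symm h2])
  obtain ⟨r3, t3⟩ := hoff (m.equivMapDomain (Equiv.swap p.castSucc p.succ)) (by
    intro i h1 h2
    simp [Finsupp.equivMapDomain_apply, Equiv.swap_apply_of_ne_of_ne h1 h2])
  rw [r1, r2, r3, t1, t2, t3]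
  by_cases hR : IsCommonExponent b p m
  · have htail := hR.tail_le (p + 2) (by omega)
    have htail' := hR.tailSum_le hbn
    have hbp : b (p + 1) ≤ b p := hb (Nat.le_succ _)
    simp only [hR, true_and, Finsupp.mem_support_iff, Finsupp.tsub_apply,
      Finsupp.equivMapDomain_apply, Equiv.symm_swap, Equiv.swap_apply_left,
      Equiv.swap_apply_right, Finsupp.single_eq_same, Finsupp.single_eq_of_ne hpq,
      Finsupp.single_eq_of_ne hpq.symm]
    split_ifs <;> first | rfl | omega
  · simp [hR]

/-- The `i`-th entry of the Lehmer code of `w`. -/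
def lehmerCode {N : ℕ} (w : Equiv.Perm (Fin N)) (i : Fin N) : ℕ :=
  (Finset.univ.filter fun j => i < j ∧ w j < w i).card

/-- A permutation is dominant if it avoids the pattern `132`. -/
def IsDominant {N : ℕ} (w : Equiv.Perm (Fin N)) : Prop :=
  ∀ a b c, a < b → b < c → ¬(w a < w c ∧ w c < w b)

theorem lehmerCode_le {N : ℕ} (w : Equiv.Perm (Fin N)) (i : Fin N) : lehmerCode w i ≤ N :=
  (Finset.card_filter_le _ _).trans (by simp)

theorem lehmerCode_le_of_lt {N : ℕ} {w : Equiv.Perm (Fin N)} {a b : Fin N} (hab : a < b)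
    (h : ∀ c, b < c → ¬(w a < w c ∧ w c < w b)) : lehmerCode w b ≤ lehmerCode w a := by
  refine Finset.card_le_card fun j hj => ?_
  simp only [Finset.mem_filter, Finset.mem_univ, true_and] at hj ⊢
  refine ⟨hab.trans hj.1, lt_of_le_of_ne (not_lt.1 fun hlt => h j hj.1 ⟨hlt, hj.2⟩) ?_⟩
  exact fun he => (hab.trans hj.1).ne' (w.injective he)

theorem lehmerCode_castSucc_le {n : ℕ} {w : Equiv.Perm (Fin (n + 1))} {i : Fin n}
    (hi : w i.castSucc < w i.succ) : lehmerCode w i.castSucc ≤ lehmerCode w i.succ := by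
  refine Finset.card_le_card fun j hj => ?_
  simp only [Finset.mem_filter, Finset.mem_univ, true_and] at hj ⊢
  refine ⟨lt_of_le_of_ne (Fin.castSucc_lt_iff_succ_le.1 hj.1) ?_, hj.2.trans hi⟩
  rintro rfl
  exact lt_asymm hi hj.2

theorem lehmerCode_mul_swap {n : ℕ} {w : Equiv.Perm (Fin (n + 1))} (hw : IsDominant w) {i : Fin n}
    (hi : w i.castSucc < w i.succ) (k : Fin (n + 1)) :
    lehmerCode (w * Equiv.swap i.castSucc i.succ) k =
      lehmerCode w k + if k = i.castSucc then 1 else 0 := by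
  have hlt : i.castSucc < i.succ := Fin.castSucc_lt_succ
  have heq : lehmerCode w i.castSucc = lehmerCode w i.succ :=
    (lehmerCode_castSucc_le hi).antisymm (lehmerCode_le_of_lt hlt fun c hc => hw _ _ c hlt hc)
  have hsucc : ∀ j, i.succ < j → Equiv.swap i.castSucc i.succ j = j := fun j hj =>
    Equiv.swap_apply_of_ne_of_ne (hlt.trans hj).ne' hj.ne'
  have hlt_iff : ∀ j : Fin (n + 1), i.castSucc < j ↔ j = i.succ ∨ i.succ < j := by
    intro j
    rw [Fin.castSucc_lt_iff_succ_le, le_iff_eq_or_lt, eq_comm]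
  by_cases h1 : k = i.castSucc
  · subst h1
    rw [if_pos rfl, heq, lehmerCode, lehmerCode, ← Finset.card_insert_of_notMem (a := i.succ)
      (by simp)]
    congr 1
    ext j
    simp only [Finset.mem_filter, Finset.mem_univ, true_and, Finset.mem_insert, Equiv.Perm.mul_apply,
      Equiv.swap_apply_left, hlt_iff]
    constructor
    · rintro ⟨rfl | hj, h⟩
      · exact Or.inl rfl
      · rw [hsucc j hj] at h
        exact Or.inr ⟨hj, h⟩
    · rintro (rfl | ⟨hj, h⟩)
      · exact ⟨Or.inl rfl, by simpa using hi⟩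
      · exact ⟨Or.inr hj, by rwa [hsucc j hj]⟩
  rw [if_neg h1, add_zero]
  by_cases h2 : k = i.succ
  · subst h2
    rw [← heq]
    unfold lehmerCode
    congr 1
    ext j
    simp only [Finset.mem_filter, Finset.mem_univ, true_and, Equiv.Perm.mul_apply,
      Equiv.swap_apply_right, hlt_iff]
    constructor
    · rintro ⟨hj, h⟩
      rw [hsucc j hj] at h
      exact ⟨Or.inr hj, h⟩
    · rintro ⟨rfl | hj, h⟩
      · exact absurd h hi.asymm
      · exact ⟨hj, by rwa [hsucc j hj]⟩
  · have hk : Equiv.swap i.castSucc i.succ k = k := Equiv.swap_apply_of_ne_of_ne h1 h2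
    refine Finset.card_equiv (Equiv.swap i.castSucc i.succ) fun j => ?_
    simp only [Finset.mem_filter, Finset.mem_univ, true_and, Equiv.Perm.mul_apply, hk]
    refine and_congr_left fun _ => ?_
    simp only [Fin.ext_iff, Fin.val_castSucc, Fin.val_succ] at h1 h2
    rw [Equiv.swap_apply_def]
    split_ifs with h3 h4
    · subst h3
      simp only [Fin.lt_def, Fin.val_castSucc, Fin.val_succ]
      omega
    · subst h4
      simp only [Fin.lt_def, Fin.val_castSucc, Fin.val_succ]
      omega
    · rfl

theorem IsDominant.mul_swap {n : ℕ} {w : Equiv.Perm (Fin (n + 1))} (hw : IsDominant w) {i : Fin n}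
    (hmin : ∀ a < i.castSucc, w i.castSucc < w a) (hi : w i.castSucc < w i.succ) :
    IsDominant (w * Equiv.swap i.castSucc i.succ) := by
  intro a b c hab hbc
  have key : ∀ x y : Fin (n + 1), x < y → ¬(x = i.castSucc ∧ y = i.succ) →
      Equiv.swap i.castSucc i.succ x < Equiv.swap i.castSucc i.succ y := by
    intro x y hxy hne
    simp only [Equiv.swap_apply_def, Fin.ext_iff, Fin.lt_def, Fin.val_castSucc,
      Fin.val_succ] at hxy hne ⊢
    split_ifs <;> try simp only [Fin.val_castSucc, Fin.val_succ]
    all_goals omega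
  simp only [Equiv.Perm.mul_apply]
  rintro ⟨h1, h2⟩
  by_cases hab' : a = i.castSucc ∧ b = i.succ
  · obtain ⟨rfl, rfl⟩ := hab'
    rw [Equiv.swap_apply_left] at h1
    rw [Equiv.swap_apply_right] at h2
    exact absurd (h1.trans h2) hi.asymm
  by_cases hbc' : b = i.castSucc ∧ c = i.succ
  · obtain ⟨rfl, rfl⟩ := hbc'
    rw [Equiv.swap_apply_right, Equiv.swap_apply_of_ne_of_ne hab.ne (hab.trans hbc).ne] at h1
    exact absurd h1 (hmin a hab).asymm
  exact hw _ _ _ (key _ _ hab hab') (key _ _ hbc hbc') ⟨h1, h2⟩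

theorem exists_first_ascent {n : ℕ} {w : Equiv.Perm (Fin (n + 1))} (hw : w ≠ Fin.revPerm) :
    ∃ i : Fin n, (∀ a < i.castSucc, w i.castSucc < w a) ∧ w i.castSucc < w i.succ := by
  by_contra! h
  refine hw ?_
  have hanti : ∀ j a : Fin (n + 1), a < j → w j < w a := by
    intro j
    induction j using Fin.induction with
    | zero => exact fun a ha => absurd ha (Fin.not_lt_zero a)
    | succ i ih =>
      have hle := lt_of_le_of_ne (h i ih) (w.injective.ne Fin.castSucc_lt_succ.ne')
      intro a ha
      rcases (Fin.le_castSucc_iff.2 ha).eq_or_lt with rfl | ha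
      · exact hle
      · exact hle.trans (ih a ha)
  have hmono : StrictMono fun a : Fin (n + 1) => w a.rev := fun a b hab =>
    hanti _ _ (Fin.rev_lt_rev.2 hab)
  have hid : (fun a : Fin (n + 1) => w a.rev) = id :=
    (hmono.range_inj strictMono_id).1
      ((w.surjective.comp Fin.rev_surjective).range_eq.trans Set.range_id.symm)
  ext1 x
  simpa using congrFun hid x.rev

theorem lehmerCode_revPerm {n : ℕ} (i : Fin (n + 1)) : lehmerCode Fin.revPerm i = n - i := by
  simp [lehmerCode, Finset.filter_lt_eq_Ioi]

theorem IsSchubertFamily.eq_prod_of_isDominant {n : ℕ}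
    {S : Equiv.Perm (Fin (n + 1)) → MvPolynomial (Fin (n + 1)) ℤ} (hS : IsSchubertFamily n S)
    (w : Equiv.Perm (Fin (n + 1))) (hw : IsDominant w) : S w = ∏ i, X i ^ lehmerCode w i := by
  induction hk : (n + 1) * (n + 1) - ∑ i, lehmerCode w i using Nat.strong_induction_on
    generalizing w with
  | _ k ih =>
  by_cases hrev : w = Fin.revPerm
  · rw [hrev, hS.1]
    simp only [lehmerCode_revPerm]
  obtain ⟨i, hmin, hi⟩ := exists_first_ascent hrev
  have hcode := lehmerCode_mul_swap hw hi
  have hlt : i.castSucc < i.succ := Fin.castSucc_lt_succ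
  have heq : lehmerCode w i.castSucc = lehmerCode w i.succ :=
    (lehmerCode_castSucc_le hi).antisymm (lehmerCode_le_of_lt hlt fun c hc => hw _ _ c hlt hc)
  have hbound : ∑ k, lehmerCode (w * Equiv.swap i.castSucc i.succ) k ≤ (n + 1) * (n + 1) :=
    (Finset.sum_le_card_nsmul _ _ (n + 1) fun k _ => lehmerCode_le _ k).trans (by simp)
  have hsum : ∑ k, lehmerCode (w * Equiv.swap i.castSucc i.succ) k = ∑ k, lehmerCode w k + 1 := by
    simp [hcode, Finset.sum_add_distrib]
  have hstep := ih _ (by omega) (w * Equiv.swap i.castSucc i.succ) (hw.mul_swap hmin hi) rfl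
  have hprod : S (w * Equiv.swap i.castSucc i.succ) =
      X i.castSucc * ∏ k, X k ^ lehmerCode w k := by
    simp only [hstep, hcode, pow_add, Finset.prod_mul_distrib, pow_ite, pow_one, pow_zero,
      Finset.prod_ite_eq', Finset.mem_univ, if_true, mul_comm]
  have hsymm : rename (Equiv.swap i.castSucc i.succ)
      (∏ k, X k ^ lehmerCode w k : MvPolynomial (Fin (n + 1)) ℤ) =
      ∏ k, X k ^ lehmerCode w k := by
    rw [map_prod]
    refine Fintype.prod_equiv (Equiv.swap i.castSucc i.succ) _ _ fun k => ?_
    rw [map_pow, rename_X]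
    congr 1
    rw [Equiv.swap_apply_def]
    split_ifs with h1 h2
    · rw [h1, heq]
    · rw [h2, heq]
    · rfl
  have hne : (X i.castSucc - X i.succ : MvPolynomial (Fin (n + 1)) ℤ) ≠ 0 := by
    rw [sub_ne_zero]
    exact fun hX => absurd (X_injective hX) hlt.ne
  refine mul_left_cancel₀ hne ?_
  rw [hS.2 w i hi, hprod, map_mul, hsymm, rename_X, Equiv.swap_apply_left, sub_mul]

/-- The Lehmer code of `π` from position `1` on. -/
def shiftedCode {n : ℕ} (π : Equiv.Perm (Fin (n + 1))) (m : ℕ) : ℕ :=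
  if h : m + 1 < n + 1 then lehmerCode π ⟨m + 1, h⟩ else 0

theorem shiftedCode_last {n : ℕ} (π : Equiv.Perm (Fin (n + 1))) : shiftedCode π n = 0 := by
  simp [shiftedCode]

theorem shiftedCode_antitone {n : ℕ} {π : Equiv.Perm (Fin (n + 1))}
    (hdom : ∀ a b c : Fin (n + 1), 0 < a → a < b → b < c → ¬(π a < π c ∧ π c < π b)) :
    Antitone (shiftedCode π) := by
  refine antitone_nat_of_succ_le fun m => ?_
  unfold shiftedCode
  split_ifs with h1 h2
  · have hlt : (⟨m + 1, h2⟩ : Fin (n + 1)) < ⟨m + 1 + 1, h1⟩ := by simp [Fin.lt_def]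
    exact lehmerCode_le_of_lt hlt fun c hc => hdom _ _ c (by simp [Fin.lt_def]) hlt hc
  · omega
  · exact Nat.zero_le _
  · exact le_rfl

theorem cycleRange_castSucc_mul_swap {n : ℕ} (p : Fin n) :
    p.castSucc.cycleRange * Equiv.swap p.castSucc p.succ = p.succ.cycleRange := by
  ext1 x
  rw [Equiv.Perm.mul_apply, Equiv.swap_apply_def]
  split_ifs with h1 h2
  · subst h1
    rw [Fin.cycleRange_of_gt Fin.castSucc_lt_succ, Fin.cycleRange_of_lt Fin.castSucc_lt_succ]
    simp
  · subst h2
    simp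
  · rcases lt_or_gt_of_ne h1 with h | h
    · rw [Fin.cycleRange_of_lt h, Fin.cycleRange_of_lt (h.trans Fin.castSucc_lt_succ)]
    · rw [Fin.cycleRange_of_gt h, Fin.cycleRange_of_gt]
      exact lt_of_le_of_ne (Fin.castSucc_lt_iff_succ_le.1 h) (Ne.symm h2)

theorem cycleRange_last_castSucc {n : ℕ} (k : Fin n) :
    (Fin.last n).cycleRange k.castSucc = k.succ := by
  rw [Fin.cycleRange_of_lt (Fin.castSucc_lt_last k), Fin.coeSucc_eq_succ]

theorem apply_succ_pos {n : ℕ} {π : Equiv.Perm (Fin (n + 1))} (hfix : π 0 = 0) (k : Fin n) :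
    0 < π k.succ := by
  refine Fin.pos_of_ne_zero fun h => Fin.succ_ne_zero k (π.injective ?_)
  rw [h, hfix]

theorem isDominant_mul_cycleRange_last {n : ℕ} {π : Equiv.Perm (Fin (n + 1))} (hfix : π 0 = 0)
    (hdom : ∀ a b c : Fin (n + 1), 0 < a → a < b → b < c → ¬(π a < π c ∧ π c < π b)) :
    IsDominant (π * (Fin.last n).cycleRange) := by
  intro a b c hab hbc
  have hb : b < Fin.last n := hbc.trans_le (Fin.le_last c)
  have ha : a < Fin.last n := hab.trans hb
  obtain ⟨a, rfl⟩ := Fin.exists_castSucc_eq.2 ha.ne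
  obtain ⟨b, rfl⟩ := Fin.exists_castSucc_eq.2 hb.ne
  induction c using Fin.lastCases with
  | last => simp [hfix]
  | cast c =>
    simp only [Equiv.Perm.mul_apply, cycleRange_last_castSucc]
    exact hdom _ _ _ (Fin.succ_pos a) (by simpa using hab) (by simpa using hbc)

theorem lehmerCode_mul_cycleRange_last_castSucc {n : ℕ} {π : Equiv.Perm (Fin (n + 1))}
    (hfix : π 0 = 0) (k : Fin n) :
    lehmerCode (π * (Fin.last n).cycleRange) k.castSucc = shiftedCode π k + 1 := by
  rw [shiftedCode, dif_pos (by omega), lehmerCode, lehmerCode,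
    ← Finset.card_insert_of_notMem (a := 0) (by simp)]
  refine Finset.card_equiv (Fin.last n).cycleRange fun j => ?_
  change _ ↔ _ ∈ insert 0 (Finset.univ.filter fun j => k.succ < j ∧ π j < π k.succ)
  simp only [Finset.mem_filter, Finset.mem_univ, true_and, Finset.mem_insert,
    Equiv.Perm.mul_apply, cycleRange_last_castSucc]
  induction j using Fin.lastCases with
  | last => simp [hfix, apply_succ_pos hfix k, Fin.castSucc_lt_last]
  | cast j => simp [Fin.succ_ne_zero]

theorem lehmerCode_last {n : ℕ} (w : Equiv.Perm (Fin (n + 1))) : lehmerCode w (Fin.last n) = 0 := by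
  rw [lehmerCode, Finset.card_eq_zero, Finset.filter_eq_empty_iff]
  exact fun j _ h => (Fin.le_last j).not_gt h.1

theorem isInsertionExponent_last_iff {n : ℕ} {b : ℕ → ℕ} (hbn : b n = 0) (d : Fin (n + 1) → ℕ) :
    IsInsertionExponent b n d ↔ (∀ i : Fin n, d i.castSucc = b i + 1) ∧ d (Fin.last n) = 0 := by
  have h1 := tailSum_eq_add d (Fin.last n)
  have h2 := tailSum_eq_add (fun i : Fin (n + 1) => b i) (Fin.last n)
  simp only [Fin.val_last, tailSum_of_le _ le_rfl, hbn, add_zero] at h1 h2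
  constructor
  · rintro ⟨ha, -, -, hd⟩
    exact ⟨fun i => ha i.castSucc (by simp), by omega⟩
  · rintro ⟨ha, hd⟩
    refine ⟨fun i hi => ?_, fun i hi => by omega, fun t ht => ?_, by omega⟩
    · exact ha ⟨i, hi⟩
    · rw [tailSum_of_le _ (by omega)]
      exact Nat.zero_le _

open Classical in
theorem IsSchubertFamily.coeff_eq {n : ℕ}
    {S : Equiv.Perm (Fin (n + 1)) → MvPolynomial (Fin (n + 1)) ℤ} (hS : IsSchubertFamily n S)
    {π : Equiv.Perm (Fin (n + 1))} (hfix : π 0 = 0)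
    (hdom : ∀ a b c : Fin (n + 1), 0 < a → a < b → b < c → ¬(π a < π c ∧ π c < π b))
    (p : Fin (n + 1)) (d : Fin (n + 1) →₀ ℕ) :
    coeff d (S (π * p.cycleRange)) =
      if IsInsertionExponent (shiftedCode π) p d then 1 else 0 := by
  induction p using Fin.reverseInduction generalizing d with
  | last =>
    rw [hS.eq_prod_of_isDominant _ (isDominant_mul_cycleRange_last hfix hdom)]
    set w := π * (Fin.last n).cycleRange
    have hmon : (∏ i, X i ^ lehmerCode w i : MvPolynomial (Fin (n + 1)) ℤ) =
        monomial (Finsupp.equivFunOnFinite.symm (lehmerCode w)) 1 := by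
      rw [monomial_eq, Finsupp.prod_fintype _ _ (by simp)]
      simp
    rw [hmon, coeff_monomial]
    refine if_congr ?_ rfl rfl
    rw [Fin.val_last, isInsertionExponent_last_iff (shiftedCode_last π), DFunLike.ext_iff,
      Fin.forall_fin_succ']
    simp only [Finsupp.equivFunOnFinite_symm_apply_apply, lehmerCode_last, w,
      lehmerCode_mul_cycleRange_last_castSucc hfix]
    simp only [eq_comm]
  | cast p ih =>
    refine coeff_of_dividedDifference (shiftedCode_antitone hdom) (shiftedCode_last π) p ih ?_ d
    rw [← cycleRange_castSucc_mul_swap, ← mul_assoc]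
    refine hS.2 _ p ?_
    rw [Equiv.Perm.mul_apply, Equiv.Perm.mul_apply, Fin.cycleRange_self,
      Fin.cycleRange_of_gt Fin.castSucc_lt_succ, hfix]
    exact apply_succ_pos hfix p

theorem tailSum_natCast {N : ℕ} (f : Fin N → ℕ) (t : ℕ) :
    tailSum (fun i => (f i : ℝ)) t = (tailSum f t : ℕ) :=
  (Nat.cast_sum _ _).symm

/-- The supermodular function `I ↦ ∑_{i ∈ I} M i - max_{i ∈ I} M i`. -/
def sumSubSup {N : ℕ} (M : Fin N → ℕ) (I : Finset (Fin N)) : ℝ :=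
  ((∑ i ∈ I, M i : ℕ) : ℝ) - ((I.sup M : ℕ) : ℝ)

/-- The generalized permutahedron with parameters `sumSubSup M`. -/
def sumSubSupPolytope {N : ℕ} (M : Fin N → ℕ) : Set (Fin N → ℝ) :=
  {x | (∀ I : Finset (Fin N), I ≠ Finset.univ → sumSubSup M I ≤ ∑ i ∈ I, x i) ∧
    ∑ i, x i = sumSubSup M Finset.univ}

theorem isGenPermutahedron_sumSubSupPolytope {N : ℕ} (M : Fin N → ℕ) :
    IsGenPermutahedron (sumSubSupPolytope M) := by
  refine ⟨sumSubSup M, by simp [sumSubSup], fun I J => ?_, rfl⟩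
  have h1 := Finset.sum_union_inter (s₁ := I) (s₂ := J) (f := M)
  have h2 : (I ∪ J).sup M = max (I.sup M) (J.sup M) := Finset.sup_union
  have h3 : (I ∩ J).sup M ≤ I.sup M := Finset.sup_mono Finset.inter_subset_left
  have h4 : (I ∩ J).sup M ≤ J.sup M := Finset.sup_mono Finset.inter_subset_right
  have h5 : (I ∪ J).sup M + (I ∩ J).sup M ≤ I.sup M + J.sup M := by omega
  have h1' : ((∑ i ∈ I ∪ J, M i : ℕ) : ℝ) + ((∑ i ∈ I ∩ J, M i : ℕ) : ℝ) =
      ((∑ i ∈ I, M i : ℕ) : ℝ) + ((∑ i ∈ J, M i : ℕ) : ℝ) := by exact_mod_cast h1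
  have h5' : (((I ∪ J).sup M : ℕ) : ℝ) + (((I ∩ J).sup M : ℕ) : ℝ) ≤
      ((I.sup M : ℕ) : ℝ) + ((J.sup M : ℕ) : ℝ) := by exact_mod_cast h5
  unfold sumSubSup
  linarith

theorem convex_sumSubSupPolytope {N : ℕ} (M : Fin N → ℕ) : Convex ℝ (sumSubSupPolytope M) := by
  intro x hx y hy a b ha hb hab
  have hsum : ∀ I : Finset (Fin N), ∑ i ∈ I, (a • x + b • y) i =
      a * ∑ i ∈ I, x i + b * ∑ i ∈ I, y i := by
    intro I
    simp [Finset.sum_add_distrib, Finset.mul_sum]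
  refine ⟨fun I hI => ?_, ?_⟩
  · rw [hsum]
    calc sumSubSup M I = a * sumSubSup M I + b * sumSubSup M I := by rw [← add_mul, hab, one_mul]
      _ ≤ _ := add_le_add (mul_le_mul_of_nonneg_left (hx.1 I hI) ha)
        (mul_le_mul_of_nonneg_left (hy.1 I hI) hb)
  · rw [hsum, hx.2, hy.2, ← add_mul, hab, one_mul]

section sumSubSupPolytope

variable {N : ℕ} {M : Fin N → ℕ} {x : Fin N → ℝ}

theorem sumSubSup_le_sum (hx : x ∈ sumSubSupPolytope M) (I : Finset (Fin N)) :
    sumSubSup M I ≤ ∑ i ∈ I, x i := by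
  by_cases hI : I = Finset.univ
  · rw [hI, hx.2]
  · exact hx.1 I hI

theorem apply_le_of_mem_sumSubSupPolytope (hx : x ∈ sumSubSupPolytope M) (i : Fin N) :
    x i ≤ M i := by
  have h1 := sumSubSup_le_sum hx (Finset.univ.erase i)
  have h2 := hx.2
  have h3 : (Finset.univ.erase i).sup M ≤ Finset.univ.sup M :=
    Finset.sup_mono (Finset.erase_subset _ _)
  have h3' : (((Finset.univ.erase i).sup M : ℕ) : ℝ) ≤ ((Finset.univ.sup M : ℕ) : ℝ) := by
    exact_mod_cast h3
  rw [sumSubSup] at h1 h2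
  rw [← Finset.add_sum_erase _ _ (Finset.mem_univ i),
    ← Finset.add_sum_erase _ _ (Finset.mem_univ i)] at h2
  push_cast at h1 h2
  linarith

theorem tailSum_sub_le_of_mem_sumSubSupPolytope (hM : Antitone M) (hx : x ∈ sumSubSupPolytope M)
    (i : Fin N) : tailSum (fun j => (M j : ℝ)) i - M i ≤ tailSum x i := by
  have h1 := sumSubSup_le_sum hx (Finset.univ.filter fun j : Fin N => (i : ℕ) ≤ j)
  have h2 : (Finset.univ.filter fun j : Fin N => (i : ℕ) ≤ j).sup M ≤ M i :=
    Finset.sup_le fun j hj => hM (by simpa using hj)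
  have h2' : (((Finset.univ.filter fun j : Fin N => (i : ℕ) ≤ j).sup M : ℕ) : ℝ) ≤ M i := by
    exact_mod_cast h2
  rw [sumSubSup] at h1
  push_cast at h1
  unfold tailSum
  linarith

end sumSubSupPolytope

theorem sup_univ_eq_apply_zero {n : ℕ} {M : Fin (n + 1) → ℕ} (hM : Antitone M) :
    Finset.univ.sup M = M 0 :=
  le_antisymm (Finset.sup_le fun j _ => hM (Fin.zero_le j)) (Finset.le_sup (Finset.mem_univ 0))

/-- The length of the part of the interval `[0, t]` inside `[j, j + 1]`. -/
def unitOverlap (j : ℕ) (t : ℝ) : ℝ := min t (j + 1) - min t j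

theorem unitOverlap_monotone (j : ℕ) : Monotone (unitOverlap j) := by
  intro s t h
  unfold unitOverlap
  simp only [min_def]
  split_ifs <;> linarith

theorem unitOverlap_of_le {j : ℕ} {t : ℝ} (h : t ≤ j) : unitOverlap j t = 0 := by
  rw [unitOverlap, min_eq_left h, min_eq_left (by linarith), sub_self]

theorem unitOverlap_of_succ_le {j : ℕ} {t : ℝ} (h : (j : ℝ) + 1 ≤ t) : unitOverlap j t = 1 := by
  rw [unitOverlap, min_eq_right h, min_eq_right (by linarith)]
  ring

theorem sum_unitOverlap {k : ℕ} {t : ℝ} (h0 : 0 ≤ t) (hk : t ≤ k) :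
    ∑ j ∈ Finset.range k, unitOverlap j t = t := by
  have := Finset.sum_range_sub (fun j : ℕ => min t j) k
  simp only [Nat.cast_add, Nat.cast_one, Nat.cast_zero, min_eq_left hk, min_eq_right h0,
    sub_zero] at this
  exact this

/-- The vector with entries `1` in the positions of `{i | j < M i}` other than `c`, provided that
`c` is one of these positions. -/
def columnVector {N : ℕ} (M : Fin N → ℕ) (j : ℕ) (c l : Fin N) : ℝ :=
  (if j < M l then 1 else 0) - if l = c then 1 else 0

theorem card_filter_range_lt {k m : ℕ} (h : m ≤ k) :
    ((Finset.range k).filter fun j => j < m).card = m := by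
  have : ((Finset.range k).filter fun j => j < m) = Finset.range m := by
    ext j
    simp
    omega
  rw [this, Finset.card_range]

theorem sum_columnVector_mem {n : ℕ} {M : Fin (n + 1) → ℕ} (hM : Antitone M)
    {c : ℕ → Fin (n + 1)} (hc : ∀ j ∈ Finset.range (M 0), j < M (c j)) :
    ∑ j ∈ Finset.range (M 0), columnVector M j (c j) ∈ sumSubSupPolytope M := by
  have hsum : ∀ I : Finset (Fin (n + 1)),
      ∑ i ∈ I, (∑ j ∈ Finset.range (M 0), columnVector M j (c j)) i =
        ((∑ i ∈ I, M i : ℕ) : ℝ) - (((Finset.range (M 0)).filter fun j => c j ∈ I).card : ℝ) := by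
    intro I
    simp only [Finset.sum_apply, columnVector, Finset.sum_sub_distrib]
    congr 1
    · push_cast
      refine Finset.sum_congr rfl fun i _ => ?_
      rw [Finset.sum_boole, card_filter_range_lt (hM (Fin.zero_le i))]
    · rw [Finset.sum_comm]
      simp
  refine ⟨fun I _ => ?_, ?_⟩
  · rw [hsum, sumSubSup]
    have : ((Finset.range (M 0)).filter fun j => c j ∈ I).card ≤ I.sup M := by
      rw [← Finset.card_range (I.sup M)]
      refine Finset.card_le_card fun j hj => ?_
      rw [Finset.mem_filter] at hj
      exact Finset.mem_range.2 ((hc j hj.1).trans_le (Finset.le_sup hj.2))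
    gcongr
  · rw [hsum, sumSubSup, sup_univ_eq_apply_zero hM]
    simp

theorem sum_columnVector_eq_natCast {N : ℕ} (M : Fin N → ℕ) (k : ℕ)
    {c : ℕ → Fin N} (hc : ∀ j ∈ Finset.range k, j < M (c j)) :
    ∃ d : Fin N →₀ ℕ, ∑ j ∈ Finset.range k, columnVector M j (c j) = fun i => (d i : ℝ) := by
  refine ⟨Finsupp.equivFunOnFinite.symm fun i =>
    ((Finset.range k).filter fun j => j < M i ∧ i ≠ c j).card, funext fun i => ?_⟩
  rw [Finsupp.equivFunOnFinite_symm_apply_apply, ← Finset.sum_boole, Finset.sum_apply]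
  refine Finset.sum_congr rfl fun j hj => ?_
  have := hc j hj
  by_cases h : i = c j
  · subst h
    simp [columnVector, this]
  · simp [columnVector, h]

open scoped Pointwise in
theorem sumSubSupPolytope_subset_convexHull {n : ℕ} {M : Fin (n + 1) → ℕ} (hM : Antitone M) :
    sumSubSupPolytope M ⊆ convexHull ℝ
      {v | ∃ d : Fin (n + 1) →₀ ℕ, v ∈ sumSubSupPolytope M ∧ v = fun i => (d i : ℝ)} := by
  intro x hx
  set T : ℕ → ℝ := fun t => tailSum (fun i => (M i : ℝ) - x i) t
  have hTsucc (i : Fin (n + 1)) : T i = (M i - x i) + T (i + 1) := tailSum_eq_add _ i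
  have hTanti (i : Fin (n + 1)) : T (i + 1) ≤ T i := by
    have := apply_le_of_mem_sumSubSupPolytope hx i
    linarith [hTsucc i]
  have hTeq (t : ℕ) : T t = tailSum (fun i => (M i : ℝ)) t - tailSum x t :=
    Finset.sum_sub_distrib _ _
  have hTle (i : Fin (n + 1)) : T i ≤ M i := by
    have := tailSum_sub_le_of_mem_sumSubSupPolytope hM hx i
    linarith [hTeq i]
  have hTnonneg (t : ℕ) : 0 ≤ T t := Finset.sum_nonneg fun i _ =>
    sub_nonneg.2 (apply_le_of_mem_sumSubSupPolytope hx i)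
  have hTzero : T 0 = M 0 := by
    rw [hTeq, tailSum_zero, tailSum_zero, hx.2, sumSubSup, sup_univ_eq_apply_zero hM]
    push_cast
    ring
  have hTlast : T (n + 1) = 0 := tailSum_of_le _ le_rfl
  have hT0 (t : ℕ) (ht : t ≤ n + 1) : T t ≤ M 0 := by
    rcases ht.eq_or_lt with rfl | ht
    · rw [hTlast]
      positivity
    · exact (hTle ⟨t, ht⟩).trans (by exact_mod_cast hM (Fin.zero_le _))
  set v : ℕ → Fin (n + 1) → ℝ := fun j i => unitOverlap j (T i) - unitOverlap j (T (i + 1))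
  have hvnonneg (j i) : 0 ≤ v j i := sub_nonneg.2 (unitOverlap_monotone j (hTanti i))
  have hvsum (j) (hj : j ∈ Finset.range (M 0)) : ∑ i, v j i = 1 := by
    rw [Fin.sum_univ_eq_sum_range
      (fun i => unitOverlap j (T i) - unitOverlap j (T (i + 1))) (n + 1), Finset.sum_range_sub',
      hTzero, hTlast, unitOverlap_of_le (Nat.cast_nonneg j), unitOverlap_of_succ_le, sub_zero]
    exact_mod_cast Finset.mem_range.1 hj
  have hvzero (j i) (h : M i ≤ j) : v j i = 0 := by
    have h1 : T i ≤ j := (hTle i).trans (by exact_mod_cast h)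
    simp only [v]
    rw [unitOverlap_of_le h1, unitOverlap_of_le ((hTanti i).trans h1), sub_zero]
  have hdecomp : x = ∑ j ∈ Finset.range (M 0), ∑ i, v j i • columnVector M j i := by
    funext l
    have hcol : ∀ j ∈ Finset.range (M 0), (∑ i, v j i • columnVector M j i) l =
        (if j < M l then 1 else 0) - v j l := by
      intro j hj
      simp [columnVector, mul_sub, Finset.sum_sub_distrib, hvsum j hj]
    rw [Finset.sum_apply, Finset.sum_congr rfl hcol, Finset.sum_sub_distrib, Finset.sum_boole,
      card_filter_range_lt (hM (Fin.zero_le l)), Finset.sum_sub_distrib,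
      sum_unitOverlap (hTnonneg _) (hT0 _ (by omega)),
      sum_unitOverlap (hTnonneg _) (hT0 _ (by omega)), hTsucc l]
    ring
  have hmem : x ∈ ∑ j ∈ Finset.range (M 0),
      convexHull ℝ {w | ∃ i, j < M i ∧ w = columnVector M j i} := by
    rw [hdecomp]
    refine Set.finsetSum_mem_finsetSum _ _ _ fun j hj => ?_
    have hfilter : ∑ i, v j i • columnVector M j i =
        ∑ i with j < M i, v j i • columnVector M j i := by
      refine (Finset.sum_filter_of_ne fun i _ hi => ?_).symm
      by_contra hlt
      exact hi (by rw [hvzero j i (by omega), zero_smul])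
    rw [hfilter]
    refine (convex_convexHull ℝ _).sum_mem (fun i _ => hvnonneg j i) ?_ fun i hi =>
      subset_convexHull ℝ _ ⟨i, by simpa using hi, rfl⟩
    rw [← hvsum j hj]
    refine Finset.sum_filter_of_ne fun i _ hi => ?_
    by_contra hlt
    exact hi (hvzero j i (by omega))
  rw [← convexHull_sum] at hmem
  refine convexHull_mono ?_ hmem
  intro w hw
  rw [Set.mem_finsetSum] at hw
  obtain ⟨g, hg, rfl⟩ := hw
  have hg' : ∀ j, ∃ i, j ∈ Finset.range (M 0) → j < M i ∧ g j = columnVector M j i := by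
    intro j
    by_cases hj : j ∈ Finset.range (M 0)
    · obtain ⟨i, hi⟩ := hg hj
      exact ⟨i, fun _ => hi⟩
    · exact ⟨0, fun h => absurd h hj⟩
  choose c hc using hg'
  have hlt : ∀ j ∈ Finset.range (M 0), j < M (c j) := fun j hj => (hc j hj).1
  rw [Finset.sum_congr rfl fun j hj => (hc j hj).2]
  obtain ⟨d, hd⟩ := sum_columnVector_eq_natCast M (M 0) hlt
  exact ⟨d, sum_columnVector_mem hM hlt, hd⟩

theorem isInsertionExponent_zero_iff {n : ℕ} {b : ℕ → ℕ} (hb : Antitone b) (hbn : b n = 0)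
    (d : Fin (n + 1) → ℕ) : IsInsertionExponent b 0 d ↔
      (fun i => (d i : ℝ)) ∈ sumSubSupPolytope fun i : Fin (n + 1) => b (i - 1) := by
  set M : Fin (n + 1) → ℕ := fun i => b (i - 1)
  have hM : Antitone M := fun i j hij => hb (by have : (i : ℕ) ≤ j := hij; omega)
  have htail (i : Fin (n + 1)) : tailSum M i = M i + tailSum (fun i : Fin (n + 1) => b i) i := by
    rw [tailSum_eq_add, ← tailSum_pred hbn]
  have htotal : ∑ i, M i = M 0 + tailSum (fun i : Fin (n + 1) => b i) 0 := by
    rw [← tailSum_zero]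
    exact htail 0
  constructor
  · intro h
    have hdM : ∀ i, d i ≤ M i := by
      intro i
      rcases Nat.eq_zero_or_pos i with hi | hi
      · have h1 := h.tail_le (i + 1) (by omega)
        have h2 := h.tail_eq
        have h3 := tailSum_eq_add d i
        have h4 := tailSum_eq_add (fun i : Fin (n + 1) => b i) i
        have h5 : M i = b i := by simp [M, hi]
        rw [← hi] at h2
        omega
      · exact h.le_of_gt i hi
    refine ⟨fun I _ => ?_, ?_⟩
    · rw [sumSubSup, sub_le_iff_le_add]
      rcases I.eq_empty_or_nonempty with rfl | hI
      · simp
      have hm : M (I.min' hI) ≤ I.sup M := Finset.le_sup (I.min'_mem hI)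
      have hle : tailSum (fun i : Fin (n + 1) => b i) (I.min' hI) ≤ tailSum d (I.min' hI) := by
        rcases Nat.eq_zero_or_pos (I.min' hI) with h0 | h0
        · rw [h0, h.tail_eq]
        · exact h.tail_le _ h0
      have hsub : I ⊆ Finset.univ.filter fun j : Fin (n + 1) => (I.min' hI : ℕ) ≤ j := by
        intro j hj
        simpa using I.min'_le j hj
      have h1 : _ = tailSum M (I.min' hI) := Finset.sum_sdiff hsub (f := M)
      have h2 : _ = tailSum d (I.min' hI) := Finset.sum_sdiff hsub (f := d)
      have h3 := Finset.sum_le_sum fun i (_ : i ∈ (Finset.univ.filter fun j : Fin (n + 1) =>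
        (I.min' hI : ℕ) ≤ j) \ I) => hdM i
      have h4 := htail (I.min' hI)
      have : ∑ i ∈ I, M i ≤ ∑ i ∈ I, d i + I.sup M := by omega
      push_cast
      exact_mod_cast this
    · have h1 := h.tail_eq
      rw [sumSubSup, sup_univ_eq_apply_zero hM, htotal, h1, tailSum_zero]
      push_cast
      ring
  · intro h
    refine ⟨fun i hi => absurd hi (Nat.not_lt_zero _), fun i _ => ?_, fun t _ => ?_, ?_⟩
    · exact_mod_cast apply_le_of_mem_sumSubSupPolytope h i
    · rcases Nat.lt_or_ge n t with ht | ht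
      · rw [tailSum_of_le _ (by omega)]
        exact Nat.zero_le _
      · have h1 := tailSum_sub_le_of_mem_sumSubSupPolytope hM h ⟨t, by omega⟩
        have h2 := htail ⟨t, by omega⟩
        have h3 : tailSum M t ≤ tailSum d t + M ⟨t, by omega⟩ := by
          rw [sub_le_iff_le_add, tailSum_natCast, tailSum_natCast] at h1
          exact_mod_cast h1
        simp only at h2
        omega
    · have h1 := h.2
      rw [sumSubSup, sup_univ_eq_apply_zero hM, htotal, ← Nat.cast_sub (by omega)] at h1
      have h2 : ∑ i, d i = M 0 + tailSum (fun i : Fin (n + 1) => b i) 0 - M 0 := by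
        simp only at h1
        exact_mod_cast h1
      rw [tailSum_zero d, h2]
      omega

/-- Theorem C, Schubert part.  Let `π = 1π' ∈ S_{n+1}` with `π'` a
dominant (i.e. 132-avoiding) permutation of `{2,…,n+1}` (0-indexed: `π 0 = 0` and `π` has
no 132-pattern in positions `> 0`).  Then every coefficient of the Schubert polynomial
`𝔖_π` is `0` or `1`, a lattice point lies in `Newton(𝔖_π)` iff the corresponding monomial
appears in `𝔖_π` with coefficient `1` (so `𝔖_π` is the integer-point transform of its
Newton polytope), and `Newton(𝔖_π)` is a generalized permutahedron. -/
theorem schubert_dominant_case (n : ℕ)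
    (S : Equiv.Perm (Fin (n + 1)) → MvPolynomial (Fin (n + 1)) ℤ)
    (hS : IsSchubertFamily n S) (π : Equiv.Perm (Fin (n + 1)))
    (hfix : π 0 = 0)
    (hdom : ∀ a b c : Fin (n + 1), 0 < a → a < b → b < c → ¬(π a < π c ∧ π c < π b)) :
    (∀ d : Fin (n + 1) →₀ ℕ, coeff d (S π) = 0 ∨ coeff d (S π) = 1) ∧
    (∀ α : Fin (n + 1) →₀ ℕ,
      ((fun i => ((α i : ℕ) : ℝ)) ∈ newtonPolytope (S π) ↔ coeff α (S π) = 1)) ∧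
    IsGenPermutahedron (newtonPolytope (S π)) := by
  classical
  set b := shiftedCode π
  have hb : Antitone b := shiftedCode_antitone hdom
  set Q := sumSubSupPolytope fun i : Fin (n + 1) => b (i - 1)
  have hcoeff (d : Fin (n + 1) →₀ ℕ) :
      coeff d (S π) = if (fun i => ((d i : ℕ) : ℝ)) ∈ Q then 1 else 0 := by
    have h := hS.coeff_eq hfix hdom 0 d
    rw [Fin.cycleRange_zero, mul_one] at h
    rw [h]
    exact if_congr (isInsertionExponent_zero_iff hb (shiftedCode_last π) d) rfl rfl
  have hM : Antitone fun i : Fin (n + 1) => b (i - 1) := fun i j hij =>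
    hb (Nat.sub_le_sub_right hij 1)
  have hnewton : newtonPolytope (S π) = Q := by
    refine (convexHull_min ?_ (convex_sumSubSupPolytope _)).antisymm ?_
    · rintro v ⟨d, hd, rfl⟩
      by_contra h
      exact mem_support_iff.1 hd (by rw [hcoeff, if_neg h])
    · refine (sumSubSupPolytope_subset_convexHull hM).trans (convexHull_mono ?_)
      rintro v ⟨d, hd, rfl⟩
      exact ⟨d, by rw [mem_support_iff, hcoeff, if_pos hd]; exact one_ne_zero, rfl⟩
  refine ⟨fun d => ?_, fun α => ?_, ?_⟩
  · rw [hcoeff]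
    exact (ite_eq_or_eq _ _ _).symm
  · rw [hnewton, hcoeff]
    simp
  · rw [hnewton]
    exact isGenPermutahedron_sumSubSupPolytope _
end
end
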